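/- Fix n ≥ 2 and suppose 𝔷 is a field and p(0) = A_n ≠ 0. Then every principal solution K(x) ∈ 𝒦_p(x) of the reflection equation with spectral parameter equals f(x) · K_p(ξ,ζ,x) for some rational function f ∈ 𝔷(x), some non-zero ξ ∈ 𝔷 and ζ = p(0)/ξ; that is, up to a factor from 𝔷(x) the principal solution is unique and given by the principal baxterized element. -/

import Mathlib

noncomputable section
namespace Baxterization
open scoped TensorProduct

/-! ## The affine Hecke algebra of rank one -/

variable (k : Type) [Field k]
variable (z : Type) [CommRing z] [Algebra k z]

/-- the two generators R and K -/
inductive G : Type | R | K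

/-- The defining relations of the affine Hecke algebra of rank one:
the Hecke condition `R² = ωR + 1` and the reflection equation `RKRK = KRKR`. -/
inductive HRel (ω : z) : FreeAlgebra z G → FreeAlgebra z G → Prop
  | hecke : HRel ω (FreeAlgebra.ι z G.R * FreeAlgebra.ι z G.R)
      (ω • FreeAlgebra.ι z G.R + 1)
  | re : HRel ω (FreeAlgebra.ι z G.R * FreeAlgebra.ι z G.K * FreeAlgebra.ι z G.R *
        FreeAlgebra.ι z G.K)
      (FreeAlgebra.ι z G.K * FreeAlgebra.ι z G.R * FreeAlgebra.ι z G.K * FreeAlgebra.ι z G.R)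

/-- The affine Hecke algebra of rank one over 𝔷, with parameter ω: the quotient of the
free algebra 𝔷⟨R,K⟩ by the ideal of relations `R² = ωR + 1` and `RKRK = KRKR`. -/
def H (ω : z) : Type := RingQuot (HRel z ω)

variable (ω : z)

instance : Ring (H z ω) := inferInstanceAs (Ring (RingQuot (HRel z ω)))
instance : Algebra z (H z ω) := inferInstanceAs (Algebra z (RingQuot (HRel z ω)))
instance : Algebra k (H z ω) := inferInstanceAs (Algebra k (RingQuot (HRel z ω)))
instance : IsScalarTower k z (H z ω) :=
  inferInstanceAs (IsScalarTower k z (RingQuot (HRel z ω)))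

/-- the generator R of the affine Hecke algebra -/
def Rg : H z ω := RingQuot.mkAlgHom z (HRel z ω) (FreeAlgebra.ι z G.R)
/-- the generator K of the affine Hecke algebra -/
def Kg : H z ω := RingQuot.mkAlgHom z (HRel z ω) (FreeAlgebra.ι z G.K)
/-- Y = RKR -/
def Yg : H z ω := Rg z ω * Kg z ω * Rg z ω

/-- the elements e_{i;j} = KⁱRKʲ - KʲRKⁱ of the affine Hecke algebra -/
def eH (i j : ℕ) : H z ω :=
  Kg z ω ^ i * Rg z ω * Kg z ω ^ j - Kg z ω ^ j * Rg z ω * Kg z ω ^ i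

/-! ## The cyclotomic Hecke algebra -/

/-- the element p(K) of H, where p(u) = -u^(n+1) + A₀ uⁿ + A₁ u^(n-1) + ⋯ + Aₙ -/
def pKelt (n : ℕ) (A : ℕ → z) : H z ω :=
  - (Kg z ω) ^ (n + 1) + ∑ i ∈ Finset.range (n + 1), A i • (Kg z ω) ^ (n - i)

/-- relation generating the two-sided ideal (p(K)) of H -/
inductive CRel (n : ℕ) (A : ℕ → z) : H z ω → H z ω → Prop
  | mk : CRel n A (pKelt z ω n A) 0

/-- The cyclotomic Hecke algebra H_p: the quotient of the affine Hecke algebra H by the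
two-sided ideal generated by p(K), where p(u) = -u^(n+1) + A₀ uⁿ + ⋯ + Aₙ. -/
def Hp (n : ℕ) (A : ℕ → z) : Type := RingQuot (CRel z ω n A)

instance (n : ℕ) (A : ℕ → z) : Ring (Hp z ω n A) :=
  inferInstanceAs (Ring (RingQuot (CRel z ω n A)))
instance (n : ℕ) (A : ℕ → z) : Algebra z (Hp z ω n A) :=
  inferInstanceAs (Algebra z (RingQuot (CRel z ω n A)))
instance (n : ℕ) (A : ℕ → z) : Algebra k (Hp z ω n A) :=
  inferInstanceAs (Algebra k (RingQuot (CRel z ω n A)))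
instance (n : ℕ) (A : ℕ → z) : IsScalarTower k z (Hp z ω n A) :=
  inferInstanceAs (IsScalarTower k z (RingQuot (CRel z ω n A)))

/-- the image of R in the cyclotomic Hecke algebra -/
def Rp (n : ℕ) (A : ℕ → z) : Hp z ω n A :=
  RingQuot.mkAlgHom z (CRel z ω n A) (Rg z ω)
/-- the image of K in the cyclotomic Hecke algebra -/
def Kp (n : ℕ) (A : ℕ → z) : Hp z ω n A :=
  RingQuot.mkAlgHom z (CRel z ω n A) (Kg z ω)
/-- Y = RKR in the cyclotomic Hecke algebra -/
def Yp (n : ℕ) (A : ℕ → z) : Hp z ω n A := Rp z ω n A * Kp z ω n A * Rp z ω n A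

/-- the elements e_{i;j} = KⁱRKʲ - KʲRKⁱ of the cyclotomic Hecke algebra -/
def eHp (n : ℕ) (A : ℕ → z) (i j : ℕ) : Hp z ω n A :=
  Kp z ω n A ^ i * Rp z ω n A * Kp z ω n A ^ j -
    Kp z ω n A ^ j * Rp z ω n A * Kp z ω n A ^ i

/-- the element K̃ = Kⁿ - A₀K^(n-1) - ⋯ - A_(n-1) of the cyclotomic Hecke algebra -/
def Ktil (n : ℕ) (A : ℕ → z) : Hp z ω n A :=
  Kp z ω n A ^ n - ∑ i ∈ Finset.range n, A i • Kp z ω n A ^ (n - 1 - i)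

/-! ## Rational functions in one and two variables, and the spectral reflection equation -/

/-- polynomials in two variables x, y over the base field -/
abbrev P2 := MvPolynomial (Fin 2) k
/-- the field k(x,y) of rational functions in the two variables x, y -/
abbrev F2 := FractionRing (P2 k)

/-- auxiliary: the embedding k[X] → k(x,y), X ↦ i-th variable -/
def embP (i : Fin 2) : Polynomial k →ₐ[k] F2 k :=
  (IsScalarTower.toAlgHom k (P2 k) (F2 k)).comp (Polynomial.aeval (MvPolynomial.X i))

lemma embP_injective (i : Fin 2) : Function.Injective (embP k i) := by
  have h : ((MvPolynomial.aeval (R := k) (fun j => if j = i then Polynomial.X else 0)).comp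
      (Polynomial.aeval (R := k) (MvPolynomial.X i : P2 k))) = AlgHom.id k (Polynomial k) := by
    apply Polynomial.algHom_ext; simp
  have hinj : Function.Injective (Polynomial.aeval (R := k) (MvPolynomial.X i : P2 k)) := by
    intro a b hab
    have h2 := congrArg (MvPolynomial.aeval (R := k)
      (fun j : Fin 2 => if j = i then (Polynomial.X : Polynomial k) else 0)) hab
    have ha := congrFun (congrArg (fun (f : Polynomial k →ₐ[k] Polynomial k) =>
      (f : Polynomial k → Polynomial k)) h) a
    have hb := congrFun (congrArg (fun (f : Polynomial k →ₐ[k] Polynomial k) =>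
      (f : Polynomial k → Polynomial k)) h) b
    simp only [AlgHom.coe_comp, Function.comp_apply, AlgHom.coe_id, id_eq] at ha hb
    rw [← ha, ← hb]; exact h2
  exact (IsFractionRing.injective (P2 k) (F2 k)).comp hinj

/-- the embedding k(x) → k(x,y) sending the variable to the i-th of the two variables -/
def emb (i : Fin 2) : RatFunc k →ₐ[k] F2 k :=
  RatFunc.liftAlgHom (embP k i)
    (nonZeroDivisors_le_comap_nonZeroDivisors_of_injective _ (embP_injective k i))

/-- the first spectral variable x, as an element of k(x,y) -/
def xvar : F2 k := algebraMap (P2 k) (F2 k) (MvPolynomial.X 0)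
/-- the second spectral variable y, as an element of k(x,y) -/
def yvar : F2 k := algebraMap (P2 k) (F2 k) (MvPolynomial.X 1)

variable {B : Type} [Ring B] [Algebra k B]

/-- substitution of the spectral variable x by the i-th of the two variables x, y:
the map B(x) → B(x,y) induced by `emb i`. -/
def iota (i : Fin 2) : RatFunc k ⊗[k] B →ₐ[k] F2 k ⊗[k] B :=
  Algebra.TensorProduct.map (emb k i) (AlgHom.id k B)

/-- the baxterized R-matrix `R(t) = R - t⁻¹ R⁻¹` (note `R⁻¹ = R - ω` by the Hecke
condition), as an element of B(x,y). -/
def RxElt (ωk : k) (Relt : B) (t : F2 k) : F2 k ⊗[k] B :=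
  (1 : F2 k) ⊗ₜ[k] Relt - t⁻¹ • ((1 : F2 k) ⊗ₜ[k] (Relt - algebraMap k B ωk))

/-- `c`, viewed as an element `K(x)` of `B(x)`, satisfies the reflection equation with
spectral parameter:  `R(x/y) K(x) R(xy) K(y) = K(y) R(xy) K(x) R(x/y)` in B(x,y). -/
def IsSol (ωk : k) (Relt : B) (c : RatFunc k ⊗[k] B) : Prop :=
  RxElt k ωk Relt (xvar k / yvar k) * iota k 0 c * RxElt k ωk Relt (xvar k * yvar k) *
      iota k 1 c =
    iota k 1 c * RxElt k ωk Relt (xvar k * yvar k) * iota k 0 c *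
      RxElt k ωk Relt (xvar k / yvar k)

variable [Algebra z B]

/-- `c` lies in `𝔷(x)·1`, i.e. `c` is a scalar element of `B(x)`
(an element with trivial B-component). -/
def IsScalarElt (c : RatFunc k ⊗[k] B) : Prop :=
  c ∈ Submodule.span (RatFunc k)
    (Set.range fun a : z => (1 : RatFunc k) ⊗ₜ[k] (algebraMap z B a))

/-- the functions φ_i(ξ,x) (φ₀ = 1, φ_{i+1} = φ_i·ξx - A_i),
viewed as (central, scalar) elements of B(x). -/
def phiT (ξ : z) (A : ℕ → z) : ℕ → RatFunc k ⊗[k] B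
  | 0 => 1
  | (i + 1) => phiT ξ A i * ((RatFunc.X : RatFunc k) ⊗ₜ[k] algebraMap z B ξ)
      - (1 : RatFunc k) ⊗ₜ[k] (algebraMap z B (A i))

/-- the principal baxterized element
`K_p(ξ,ζ,x) = ∑_{i=0}^{n-1} φ_i(ξ,x) K^{n-i} + (ζ - x⁻¹ φ_n(ξ,x))/(x - x⁻¹)`,
as an element of 𝒦_p(x) ⊆ H_p(x). -/
def KxMain (n : ℕ) (A : ℕ → z) (ξ ζ : z) : RatFunc k ⊗[k] Hp z ω n A :=
  (∑ i ∈ Finset.range n,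
      phiT k z (B := Hp z ω n A) ξ A i * ((1 : RatFunc k) ⊗ₜ[k] (Kp z ω n A) ^ (n - i))) +
    ((RatFunc.X - RatFunc.X⁻¹)⁻¹ : RatFunc k) •
      ((1 : RatFunc k) ⊗ₜ[k] algebraMap z (Hp z ω n A) ζ -
        (RatFunc.X⁻¹ : RatFunc k) • phiT k z (B := Hp z ω n A) ξ A n)

/-- the scalar function ψ(ξ,ζ,x) = (-ξⁿx^{n+1} + ∑_{i=0}^{n-1} A_i ξ^{n-1-i} x^{n-i} + ζ)/(x-x⁻¹),
viewed as a (scalar) element of H_p(x). -/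
def psiT (n : ℕ) (A : ℕ → z) (ξ ζ : z) : RatFunc k ⊗[k] Hp z ω n A :=
  ((RatFunc.X - RatFunc.X⁻¹)⁻¹ : RatFunc k) •
    (((∑ i ∈ Finset.range n,
        (RatFunc.X ^ (n - i) : RatFunc k) ⊗ₜ[k]
          algebraMap z (Hp z ω n A) (A i * ξ ^ (n - 1 - i))) +
      (1 : RatFunc k) ⊗ₜ[k] algebraMap z (Hp z ω n A) ζ) -
      ((RatFunc.X ^ (n + 1) : RatFunc k) ⊗ₜ[k] algebraMap z (Hp z ω n A) (ξ ^ n)))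

/-- An element of 𝒦_p(x) is a *principal* solution if n = 1, or if n > 1 and the
coefficient of K^(n-1) in its expansion over the basis {1, K, …, K^(n-1), K̃} of 𝒦_p,
where K̃ = Kⁿ - A₀K^(n-1) - ⋯ - A_(n-1), is non-zero. -/
def IsPrincipal (n : ℕ) (A : ℕ → z) (c : RatFunc k ⊗[k] Hp z ω n A) : Prop :=
  n = 1 ∨ (1 < n ∧ ∃ f : ℕ → RatFunc k ⊗[k] Hp z ω n A,
    (∀ i, IsScalarElt k z (B := Hp z ω n A) (f i)) ∧
    c = (∑ i ∈ Finset.range n, f i * ((1 : RatFunc k) ⊗ₜ[k] (Kp z ω n A) ^ i)) +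
        f n * ((1 : RatFunc k) ⊗ₜ[k] Ktil z ω n A) ∧
    f (n - 1) ≠ 0)

/-! ## Commutative auxiliaries: the polynomial p, the functions φ and the coefficients A⁽ᵐ⁾ -/

/-- the polynomial p(u) = -u^(n+1) + A₀ uⁿ + ⋯ + Aₙ -/
def pPoly (n : ℕ) (A : ℕ → z) : Polynomial z :=
  - Polynomial.X ^ (n + 1) +
    ∑ i ∈ Finset.range (n + 1), Polynomial.C (A i) * Polynomial.X ^ (n - i)

/-- the polynomials φ_i(ξ,x) ∈ 𝔷[x]: φ₀ = 1, φ_{i+1} = φ_i·ξx - A_i -/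
def phiP (A : ℕ → z) (ξ : z) : ℕ → Polynomial z
  | 0 => 1
  | (i + 1) => phiP A ξ i * (Polynomial.C ξ * Polynomial.X) - Polynomial.C (A i)

/-- the monic polynomial u^(n+1) - A₀uⁿ - ⋯ - Aₙ (i.e. -p(u)) -/
def qPoly (n : ℕ) (A : ℕ → z) : Polynomial z :=
  Polynomial.X ^ (n + 1) -
    ∑ i ∈ Finset.range (n + 1), Polynomial.C (A i) * Polynomial.X ^ (n - i)

/-- the coefficients A⁽ᵐ⁾_i ∈ 𝔷 defined by uᵐ ≡ ∑_{i=0}^n A⁽ᵐ⁾_i u^{n-i}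
modulo the monic polynomial u^(n+1) - A₀uⁿ - ⋯ - Aₙ -/
def Am (n : ℕ) (A : ℕ → z) (m i : ℕ) : z :=
  ((Polynomial.X : Polynomial z) ^ m %ₘ qPoly z n A).coeff (n - i)

/-- polynomials in two variables over 𝔷 -/
abbrev ZP2 := MvPolynomial (Fin 2) z

/-- the embedding 𝔷[u] → 𝔷[x,y] sending u to the i-th variable -/
def evP (i : Fin 2) : Polynomial z →ₐ[z] ZP2 z := Polynomial.aeval (MvPolynomial.X i)

/-- The subalgebra 𝒦_p(x) of H_p(x): rational functions of x with values in the
subalgebra 𝒦_p ⊆ H_p generated by K (over 𝔷). -/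
def KpX (n : ℕ) (A : ℕ → z) : Subalgebra (RatFunc k) (RatFunc k ⊗[k] Hp z ω n A) :=
  Algebra.adjoin (RatFunc k)
    ({(1 : RatFunc k) ⊗ₜ[k] Kp z ω n A} ∪
      Set.range (fun a : z => (1 : RatFunc k) ⊗ₜ[k] algebraMap z (Hp z ω n A) a))
open Polynomial in
/-- Extracting the coefficients of a principal solution from the scalar form of the reflection
equation: `D i`, `δ i` are the coordinates of `f` and `u f` in the basis
`1, u, …, u^(n-1), ũ`, and `w`, `v` those of `f(x) f(y)` and `u f(x) f(y)`. -/
theorem coordinates_of_symmetric_equation {z : Type} [Field z] [CharZero z] (n : ℕ) (hn : 2 ≤ n)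
    (A : ℕ → z) (hA : A n ≠ 0) {Λ : Type} [Field Λ] [CharZero Λ] (ex ey : z[X] →+* Λ)
    (hC : ∀ a, ey (C a) = ex (C a)) (hex : Function.Injective ex) (hey : Function.Injective ey)
    (hxy : ex X - ey X ≠ 0) (hN : ex X * ey X - 1 ≠ 0)
    (hUV : ∀ U V : z[X], ex U * ey V = ey U * ex V → V ≠ 0 → ∃ c : z, U = C c * V)
    (D δ : ℕ → z[X]) (w v : ℕ → Λ) (hD : D (n - 1) ≠ 0)
    (hδn : δ n = D (n - 1)) (hδ0 : δ 0 = C (A n) * D n + C (A (n - 1)) * D (n - 1))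
    (hδ : ∀ i, i + 1 < n → δ (i + 1) = D i + C (A (n - 2 - i)) * D (n - 1))
    (hvn : v n = w (n - 1)) (hv0 : v 0 = ex (C (A n)) * w n + ex (C (A (n - 1))) * w (n - 1))
    (heq : ∀ i ≤ n, ∀ j ≤ n, (ex X * ey X - 1) *
        (ex X * (ex (D i) * ey (δ j) + ex (D j) * ey (δ i)) -
          ey X * (ex (δ i) * ey (D j) + ex (δ j) * ey (D i))) =
      (ex X - ey X) * (ex X * ey X * (w i * (if j = 1 then 1 else 0) + w j * (if i = 1 then 1 else 0))
        - (v i * (if j = 0 then 1 else 0) + v j * (if i = 0 then 1 else 0)))) :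
    ∃ ξ : z, ξ ≠ 0 ∧
      (∀ i, i + 2 ≤ n → D (n - 1 - i) - D n * C (A i) = D n * phiP z A ξ (i + 1)) ∧
      (X ^ 2 - 1) * (D 0 - D n * C (A (n - 1))) =
        D n * (C (A n / ξ) * X - phiP z A ξ n) := by
  have hx : ex X ≠ 0 := (map_ne_zero_iff ex hex).2 X_ne_zero
  have hy : ey X ≠ 0 := (map_ne_zero_iff ey hey).2 X_ne_zero
  have hdx : ex (D (n - 1)) ≠ 0 := (map_ne_zero_iff ex hex).2 hD
  have hdy : ey (D (n - 1)) ≠ 0 := (map_ne_zero_iff ey hey).2 hD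
  have hAΛ : ex (C (A n)) ≠ 0 := (map_ne_zero_iff ex hex).2 (C_ne_zero.2 hA)
  have n1 : n ≠ 1 := by omega
  have n0 : n ≠ 0 := by omega
  set d := D (n - 1) with hd
  obtain ⟨κ, hκ⟩ : ∃ κ, X * D n = C κ * d := by
    refine hUV _ _ ?_ hD
    have h := heq n le_rfl n le_rfl
    simp only [n1, n0, if_false, hδn] at h
    have h2 : (2 * (ex X * ey X - 1)) *
        (ex (X * D n) * ey d - ey (X * D n) * ex d) = 0 := by
      rw [map_mul, map_mul]; linear_combination h
    simpa [hN, sub_eq_zero] using h2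
  have hκx : ex X * ex (D n) = ex (C κ) * ex d := by rw [← map_mul, hκ, map_mul]
  have hκy : ey X * ey (D n) = ex (C κ) * ey d := by rw [← map_mul, hκ, map_mul, hC]
  have hrel : ∀ i, i + 2 < n → C κ * δ (i + 2) = X * D (i + 2) := by
    have step : ∀ i, i + 2 < n → ∃ γ, C κ * δ (i + 2) - X * D (i + 2) = C γ * d := by
      intro i hi
      refine hUV _ _ ?_ hD
      have h := heq n le_rfl (i + 2) (by omega)
      have e1 : i + 2 ≠ 1 := by omega
      simp only [n1, n0, e1, if_false, hδn, Nat.add_eq_zero_iff, OfNat.ofNat_ne_zero,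
        and_false] at h
      refine mul_left_cancel₀ hN ?_
      simp only [map_sub, map_mul, hC]
      linear_combination -h + (ex X * ey X - 1) * ey (δ (i + 2)) * hκx -
        (ex X * ey X - 1) * ex (δ (i + 2)) * hκy
    have key : ∀ γ, (2 * (ex X * ey X - 1) * (ex X - ey X) * ex d * ey d) * ex (C γ) = 0 →
        γ = 0 := by
      intro γ h
      have h' : ex (C γ) = 0 := by simpa [hN, hxy, hdx, hdy] using h
      rwa [map_eq_zero_iff ex hex, C_eq_zero] at h'
    have key' : ∀ γ, ((ex X * ey X - 1) * (ex X - ey X) * ex d * ey d) * ex (C γ) = 0 →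
        γ = 0 := fun γ h => key γ (by linear_combination 2 * h)
    have last : 3 ≤ n → C κ * δ (n - 1) = X * d := by
      intro h3
      obtain ⟨γ, hγ⟩ := step (n - 3) (by omega)
      have e : n - 3 + 2 = n - 1 := by omega
      rw [e, ← hd] at hγ
      have hγx := congrArg ex hγ
      have hγy := congrArg ey hγ
      have h := heq (n - 1) (by omega) (n - 1) (by omega)
      have e1 : n - 1 ≠ 1 := by omega
      have e0 : n - 1 ≠ 0 := by omega
      simp only [e1, e0, if_false, ← hd] at h
      simp only [map_sub, map_mul, hC] at hγx hγy
      have : γ = 0 := key γ (by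
        linear_combination ex (C κ) * h - 2 * (ex X * ey X - 1) * ex X * ex d * hγy +
          2 * (ex X * ey X - 1) * ey X * ey d * hγx)
      rw [this, C_0, zero_mul, sub_eq_zero] at hγ
      exact hγ
    intro i hi
    obtain ⟨γ, hγ⟩ := step i hi
    have hl := last (by omega)
    have hlx := congrArg ex hl
    have hly := congrArg ey hl
    have hγx := congrArg ex hγ
    have hγy := congrArg ey hγ
    have h := heq (i + 2) (by omega) (n - 1) (by omega)
    have e1 : n - 1 ≠ 1 := by omega
    have e0 : n - 1 ≠ 0 := by omega
    have e3 : i + 2 ≠ 1 := by omega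
    have e4 : i + 2 ≠ 0 := by omega
    simp only [e1, e0, e3, e4, if_false, ← hd] at h
    simp only [map_sub, map_mul, hC] at hγx hγy hlx hly
    have : γ = 0 := key' γ (by
      linear_combination ex (C κ) * h - (ex X * ey X - 1) * ex X * ex d * hγy +
          (ex X * ey X - 1) * ey X * ey d * hγx
          - (ex X * ey X - 1) * ex X * ex (D (i + 2)) * hly
          + (ex X * ey X - 1) * ey X * ey (D (i + 2)) * hlx)
    rw [this, C_0, zero_mul, sub_eq_zero] at hγ
    exact hγ
  have h0x := congrArg ex hδ0
  have h0y := congrArg ey hδ0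
  simp only [map_add, map_mul, hC] at h0x h0y
  have eq1 := heq n le_rfl 0 (Nat.zero_le _)
  simp only [n1, n0, if_false, if_true, hδn, zero_ne_one, hvn] at eq1
  have eq2 := heq n le_rfl 1 (by omega)
  simp only [n1, n0, if_false, if_true, hδn, one_ne_zero] at eq2
  have eq4 := heq 0 (Nat.zero_le _) 0 (Nat.zero_le _)
  simp only [if_false, if_true, zero_ne_one, hv0] at eq4
  have hκ0 : κ ≠ 0 := by
    intro h
    rw [h, C_0, zero_mul] at hκ
    have he : D n = 0 := (mul_eq_zero.1 hκ).resolve_left X_ne_zero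
    rcases hn.lt_or_eq with h3 | h2
    · have := hrel (n - 3) (by omega)
      rw [h, C_0, zero_mul, show n - 3 + 2 = n - 1 by omega, ← hd] at this
      exact mul_ne_zero X_ne_zero hD this.symm
    · have hd1 : D 1 = d := by rw [hd, ← h2]
      simp only [he, hd1, map_zero, mul_zero, zero_mul, zero_add] at eq1 eq2 eq4 h0x h0y
      have hw : ((ex X - ey X) * ex (C (A n))) * w n = 0 := by
        linear_combination (1 / 2) * eq4 - ex (C (A (n - 1))) * eq1 -
          (ex X * ey X - 1) * (ex X * ex (D 0) * h0y - ey X * ey (D 0) * h0x)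
      have hw' : w n = 0 := by simpa [hxy, hAΛ] using hw
      rw [hw'] at eq2
      have : ((ex X * ey X - 1) * (ex X - ey X)) * (ex d * ey d) = 0 := by
        linear_combination eq2
      simp [hN, hxy, hdx, hdy] at this
  have hCκ : ex (C κ) ≠ 0 := (map_ne_zero_iff ex hex).2 (C_ne_zero.2 hκ0)
  obtain ⟨η, hη⟩ : ∃ η, η = C κ * δ 1 - X * D 1 := ⟨_, rfl⟩
  obtain ⟨θ, hθ⟩ : ∃ θ, θ = C κ * δ 0 - X * D 0 := ⟨_, rfl⟩
  have hηx := congrArg ex hη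
  have hηy := congrArg ey hη
  have hθx := congrArg ex hθ
  have hθy := congrArg ey hθ
  simp only [map_sub, map_mul, hC] at hηx hηy hθx hθy
  have eq1' : (ex X * ey X - 1) * (ex d * ey θ - ey d * ex θ) =
      -((ex X - ey X) * w (n - 1)) := by
    rw [hθx, hθy]
    linear_combination eq1 - (ex X * ey X - 1) * ey (δ 0) * hκx +
      (ex X * ey X - 1) * ex (δ 0) * hκy
  have eq2' : (ex X * ey X - 1) * (ex d * ey η - ey d * ex η) =
      (ex X - ey X) * (ex X * ey X * w n) := by
    rw [hηx, hηy]
    linear_combination eq2 - (ex X * ey X - 1) * ey (δ 1) * hκx +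
      (ex X * ey X - 1) * ex (δ 1) * hκy
  have eq3 : (ex X * ey X - 1) * (ex X * ex d * ey η - ey X * ey d * ex η) =
      ex (C κ) * (ex X - ey X) * (ex X * ey X * w (n - 1)) := by
    have h := heq (n - 1) (by omega) 1 (by omega)
    rw [hηx, hηy]
    rcases hn.lt_or_eq with h3 | h2
    · have e1 : n - 1 ≠ 1 := by omega
      have e0 : n - 1 ≠ 0 := by omega
      simp only [e1, e0, if_false, if_true, one_ne_zero, ← hd] at h
      have hl := hrel (n - 3) (by omega)
      rw [show n - 3 + 2 = n - 1 by omega, ← hd] at hl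
      have hlx := congrArg ex hl
      have hly := congrArg ey hl
      simp only [map_mul, hC] at hlx hly
      linear_combination ex (C κ) * h - (ex X * ey X - 1) * ex X * ex (D 1) * hly +
        (ex X * ey X - 1) * ey X * ey (D 1) * hlx
    · have hd1 : D 1 = d := by rw [hd, ← h2]
      have e1 : n - 1 = 1 := by omega
      simp only [e1, if_false, if_true, one_ne_zero, hd1] at h ⊢
      linear_combination ex (C κ) / 2 * h
  obtain ⟨γ, hγ⟩ : ∃ γ, X * C κ * θ + η = C γ * (X * d) := by
    refine hUV _ _ ?_ (mul_ne_zero X_ne_zero hD)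
    refine mul_left_cancel₀ hN ?_
    simp only [map_add, map_mul, hC]
    linear_combination -eq3 - ex (C κ) * ex X * ey X * eq1'
  have hγ0 : γ = 0 := by
    have hγx := congrArg ex hγ
    have hγy := congrArg ey hγ
    simp only [map_add, map_mul, hC] at hγx hγy
    have : (ex (C κ) * ex (C (A n)) * (ex X * ey X - 1) * (ex X - ey X) * ex d * ey d) *
        ex (C γ) = 0 := by
      linear_combination -ex (C κ) * (ex X * ey X / 2 * eq4 + ex (C (A n)) * eq2' -
          ex (C (A (n - 1))) * ex X * ey X * eq1') +
        (ex X * ey X - 1) * (ex (C κ) * ex (C (A n)) * (ex d * hγy - ey d * hγx +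
          ey X * ey θ * hκx - ex X * ex θ * hκy) + ex X * ey X * (ey X * ey (D 0) * hθx -
          ex X * ex (D 0) * hθy + ey θ * (hθx + ex (C κ) * h0x) - ex θ * (hθy + ex (C κ) * h0y)))
    have h' : ex (C γ) = 0 := by simpa [hN, hxy, hdx, hdy, hAΛ, hCκ] using this
    rwa [map_eq_zero_iff ex hex, C_eq_zero] at h'
  rw [hγ0, C_0, zero_mul] at hγ
  have hκκ : C κ⁻¹ * C κ = (1 : z[X]) := by rw [← C_mul, inv_mul_cancel₀ hκ0, C_1]
  have hde : d = D n * (C κ⁻¹ * X) := by linear_combination -C κ⁻¹ * hκ + (-d) * hκκ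
  have hstep : ∀ i, i + 2 ≤ n → D (n - 1 - i) = D n * phiP z A κ⁻¹ i * (C κ⁻¹ * X) := by
    intro i
    induction i with
    | zero => intro _; simpa [phiP] using hde
    | succ i ih =>
      intro hi
      have h1 := ih (by omega)
      have h2 := hrel (n - 3 - i) (by omega)
      rw [hδ _ (by omega), show n - 3 - i + 2 = n - 1 - i by omega,
        show n - 3 - i + 1 = n - 1 - (i + 1) by omega, h1,
        show n - 2 - (n - 1 - (i + 1)) = i by omega] at h2
      rw [phiP]
      linear_combination C κ⁻¹ * h2 - (D (n - 1 - (i + 1)) + C (A i) * d) * hκκ - C (A i) * hde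
  have hstep' : ∀ i, i + 2 ≤ n →
      D (n - 1 - i) - D n * C (A i) = D n * phiP z A κ⁻¹ (i + 1) := by
    intro i hi
    rw [hstep i hi, phiP]; ring
  refine ⟨κ⁻¹, inv_ne_zero hκ0, hstep', ?_⟩
  obtain ⟨m, rfl⟩ : ∃ m, n = m + 2 := ⟨n - 2, by omega⟩
  have h1 := hstep m le_rfl
  have h2 := hδ 0 (by omega)
  rw [show m + 2 - 1 - m = 1 by omega] at h1
  rw [show m + 2 - 2 - 0 = m by omega, zero_add] at h2
  rw [phiP, phiP, div_eq_mul_inv, inv_inv, C_mul]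
  rw [hη, hθ, h1, h2, hδ0] at hγ
  simp only [show m + 2 - 1 = m + 1 by omega] at hγ ⊢
  linear_combination -C κ⁻¹ * hγ + C κ⁻¹ * (C κ ^ 2 * X * C (A (m + 1)) + C κ * C (A m)) * hde +
    (C κ * X * C (A (m + 2)) * D (m + 2) +
      (C κ⁻¹ * C κ + 1) * C (A (m + 1)) * X ^ 2 * D (m + 2) - X ^ 2 * D 0 + D 0 +
      C (A m) * D (m + 2) * C κ⁻¹ * X) * hκκ

section Coordinates
open Polynomial

variable {Λ : Type} [Field Λ]

lemma degree_sum_lt (n : ℕ) (a : ℕ → Λ) :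
    (∑ i ∈ Finset.range (n + 1), C (a i) * X ^ (n - i)).degree < ((n + 1 : ℕ) : WithBot ℕ) := by
  refine (degree_sum_le _ _).trans_lt ((Finset.sup_lt_iff (WithBot.bot_lt_coe _)).2 fun i _ => ?_)
  refine (degree_C_mul_X_pow_le _ _).trans_lt ?_
  exact_mod_cast Nat.lt_succ_of_le (Nat.sub_le n i)

lemma qPoly_monic (n : ℕ) (a : ℕ → Λ) : (qPoly Λ n a).Monic :=
  monic_X_pow_sub (degree_sum_lt n a)

lemma qPoly_degree (n : ℕ) (a : ℕ → Λ) : (qPoly Λ n a).degree = ((n + 1 : ℕ) : WithBot ℕ) := by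
  unfold qPoly
  rw [degree_sub_eq_left_of_degree_lt, degree_X_pow]
  rw [degree_X_pow]
  exact degree_sum_lt n a

lemma qPoly_coeff (n : ℕ) (a : ℕ → Λ) (i : ℕ) (hi : i ≤ n) :
    (qPoly Λ n a).coeff i = -a (n - i) := by
  unfold qPoly
  simp only [coeff_sub, coeff_X_pow, finsetSum_coeff, coeff_C_mul]
  rw [Finset.sum_eq_single (n - i), if_neg (by omega), if_pos (by omega)]
  · ring
  · intro j hj hne
    rw [Finset.mem_range] at hj
    rw [if_neg (by omega), mul_zero]
  · intro h
    rw [Finset.mem_range] at h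
    omega

/-- The `i`-th coordinate with respect to the power basis of `Λ[u]/(p)`. -/
def powCoord (n : ℕ) (a : ℕ → Λ) (i : ℕ) : AdjoinRoot (qPoly Λ n a) →ₗ[Λ] Λ :=
  (lcoeff Λ i).comp (AdjoinRoot.modByMonicHom (qPoly_monic n a))

lemma powCoord_mk (n : ℕ) (a : ℕ → Λ) (i : ℕ) (f : Λ[X]) (hf : f.degree < (n + 1 : ℕ)) :
    powCoord n a i (AdjoinRoot.mk _ f) = f.coeff i := by
  simp only [powCoord, LinearMap.comp_apply, AdjoinRoot.modByMonicHom_mk, lcoeff_apply]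
  rw [(modByMonic_eq_self_iff (qPoly_monic n a)).2 (by rwa [qPoly_degree])]

lemma exists_mk_eq (n : ℕ) (a : ℕ → Λ) (w : AdjoinRoot (qPoly Λ n a)) :
    ∃ f : Λ[X], f.degree < (n + 1 : ℕ) ∧ AdjoinRoot.mk _ f = w := by
  obtain ⟨g, rfl⟩ := AdjoinRoot.mk_surjective w
  refine ⟨g %ₘ qPoly Λ n a, ?_, ?_⟩
  · rw [← qPoly_degree n a]
    exact degree_modByMonic_lt _ (qPoly_monic n a)
  · rw [AdjoinRoot.mk_eq_mk, modByMonic_eq_sub_mul_div]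
    exact ⟨-(g /ₘ qPoly Λ n a), by ring⟩

lemma powCoord_root_mul (n : ℕ) (a : ℕ → Λ) (w : AdjoinRoot (qPoly Λ n a)) (i : ℕ)
    (hi : i ≤ n) : powCoord n a i (AdjoinRoot.root _ * w) =
      (if i = 0 then 0 else powCoord n a (i - 1) w) + a (n - i) * powCoord n a n w := by
  obtain ⟨f, hf, rfl⟩ := exists_mk_eq n a w
  have h : AdjoinRoot.root (qPoly Λ n a) * AdjoinRoot.mk _ f =
      AdjoinRoot.mk _ (X * f - C (f.coeff n) * qPoly Λ n a) := by
    rw [← AdjoinRoot.mk_X, ← map_mul, AdjoinRoot.mk_eq_mk]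
    exact ⟨C (f.coeff n), by ring⟩
  have hdeg : (X * f - C (f.coeff n) * qPoly Λ n a).degree <
      ((n + 1 : ℕ) : WithBot ℕ) := by
    rw [degree_lt_iff_coeff_zero] at hf ⊢
    intro m hm
    obtain ⟨m, rfl⟩ : ∃ l, m = l + 1 := ⟨m - 1, by omega⟩
    rw [coeff_sub, coeff_X_mul, coeff_C_mul]
    rcases hm.lt_or_eq with h | h
    · rw [hf m (by omega), coeff_eq_zero_of_degree_lt (p := qPoly Λ n a), mul_zero, sub_zero]
      rw [qPoly_degree]
      exact_mod_cast h
    · have : (qPoly Λ n a).coeff (n + 1) = 1 := by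
        have := qPoly_monic n a
        rwa [Monic, leadingCoeff, natDegree_eq_of_degree_eq_some (qPoly_degree n a)] at this
      rw [← h, this]
      have : m = n := by omega
      rw [this]; ring
  rw [h, powCoord_mk _ _ _ _ hdeg, powCoord_mk _ _ _ _ hf, powCoord_mk _ _ _ _ hf,
    coeff_sub, coeff_C_mul, qPoly_coeff n a i hi]
  cases i with
  | zero => simp; ring
  | succ i => simp [coeff_X_mul]; ring

/-- The coordinates with respect to the basis `1, u, …, u^(n-1), ũ` of `Λ[u]/(p)`. -/
def tilCoord (n : ℕ) (a : ℕ → Λ) (i : ℕ) : AdjoinRoot (qPoly Λ n a) →ₗ[Λ] Λ :=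
  powCoord n a i + (if i < n then a (n - 1 - i) else 0) • powCoord n a n

lemma tilCoord_root_mul (n : ℕ) (a : ℕ → Λ) (hn : n ≠ 0) (w : AdjoinRoot (qPoly Λ n a)) :
    tilCoord n a n (AdjoinRoot.root _ * w) = tilCoord n a (n - 1) w ∧
    tilCoord n a 0 (AdjoinRoot.root _ * w) =
      a n * tilCoord n a n w + a (n - 1) * tilCoord n a (n - 1) w ∧
    ∀ i, i + 1 < n → tilCoord n a (i + 1) (AdjoinRoot.root _ * w) =
      tilCoord n a i w + a (n - 2 - i) * tilCoord n a (n - 1) w := by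
  have h1 : n - 1 < n := by omega
  have h0 : 0 < n := by omega
  refine ⟨?_, ?_, fun i hi => ?_⟩
  · simp [tilCoord, powCoord_root_mul, hn, h1]
  · simp [tilCoord, powCoord_root_mul, hn, h1, h0]
  · simp [tilCoord, powCoord_root_mul, hn, h1, hi, hi.le, (Nat.lt_succ_self i).trans hi]
    rw [show n - 1 - (i + 1) = n - 2 - i by omega, show n - (i + 1) = n - 1 - i by omega]

lemma powCoord_root_pow (n : ℕ) (a : ℕ → Λ) (i j : ℕ) (hj : j ≤ n) :
    powCoord n a i (AdjoinRoot.root _ ^ j) = if i = j then 1 else 0 := by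
  rw [← AdjoinRoot.mk_X, ← map_pow, powCoord_mk, coeff_X_pow]
  rw [degree_X_pow]
  exact_mod_cast Nat.lt_succ_of_le hj

lemma tilCoord_root_pow (n : ℕ) (a : ℕ → Λ) (i j : ℕ) (hj : j < n) :
    tilCoord n a i (AdjoinRoot.root _ ^ j) = if i = j then 1 else 0 := by
  have h0 : ¬ n = j := hj.ne'
  by_cases hi : i < n <;> simp [tilCoord, powCoord_root_pow, hj.le, h0, hi]

lemma tilCoord_expansion (n : ℕ) (a d : ℕ → Λ) (i : ℕ) (hi : i ≤ n) :
    tilCoord n a i (AdjoinRoot.mk _ (∑ j ∈ Finset.range n, C (d j) * X ^ j +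
      C (d n) * (X ^ n - ∑ j ∈ Finset.range n, C (a j) * X ^ (n - 1 - j)))) = d i := by
  have key : ∀ j, tilCoord n a i (AdjoinRoot.mk _ (C (d j) * X ^ j)) =
      d j * tilCoord n a i (AdjoinRoot.root _ ^ j) := by
    intro j
    rw [map_mul, AdjoinRoot.mk_C, map_pow, AdjoinRoot.mk_X, ← AdjoinRoot.algebraMap_eq,
      ← Algebra.smul_def, map_smul, smul_eq_mul]
  have htil : tilCoord n a i (AdjoinRoot.mk (qPoly Λ n a)
      (X ^ n - ∑ j ∈ Finset.range n, C (a j) * X ^ (n - 1 - j))) = if i = n then 1 else 0 := by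
    rw [map_sub, map_sum, map_sub, map_sum, map_pow, AdjoinRoot.mk_X]
    have : ∀ j ∈ Finset.range n, tilCoord n a i (AdjoinRoot.mk (qPoly Λ n a)
        (C (a j) * X ^ (n - 1 - j))) = a j * if i = n - 1 - j then 1 else 0 := by
      intro j hj
      rw [Finset.mem_range] at hj
      rw [map_mul, AdjoinRoot.mk_C, map_pow, AdjoinRoot.mk_X, ← AdjoinRoot.algebraMap_eq,
        ← Algebra.smul_def, map_smul, smul_eq_mul, tilCoord_root_pow _ _ _ _ (by omega)]
    rw [Finset.sum_congr rfl this]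
    rcases hi.lt_or_eq with h | rfl
    · rw [Finset.sum_eq_single (n - 1 - i), if_pos (by omega), if_neg h.ne]
      · simp [tilCoord, powCoord_root_pow, h, h.ne]
      · intro j hj hne
        rw [Finset.mem_range] at hj
        rw [if_neg (by omega), mul_zero]
      · intro h'
        rw [Finset.mem_range] at h'
        omega
    · rw [Finset.sum_eq_zero]
      · simp [tilCoord, powCoord_root_pow]
      · intro j hj
        rw [Finset.mem_range] at hj
        rw [if_neg (by omega), mul_zero]
  rw [map_add, map_add, map_sum, map_sum, map_mul, AdjoinRoot.mk_C, ← AdjoinRoot.algebraMap_eq,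
    ← Algebra.smul_def, map_smul, smul_eq_mul, htil]
  rw [Finset.sum_congr rfl fun j hj => by
    rw [key j, tilCoord_root_pow _ _ _ _ (Finset.mem_range.1 hj)]]
  rcases hi.lt_or_eq with h | rfl
  · rw [Finset.sum_eq_single i]
    · simp [h.ne]
    · intro j _ hne
      simp [hne.symm]
    · simp [h]
  · rw [Finset.sum_eq_zero]
    · simp
    · intro j hj
      rw [Finset.mem_range] at hj
      rw [if_neg (by omega), mul_zero]

/-- The reflection equation in scalar form on `Λ[u]/(p) ⊗ Λ[u]/(p)`, read off in coordinates. -/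
lemma coordinates_of_tensor_equation (n : ℕ) (a : ℕ → Λ) (x y : Λ)
    (f g : AdjoinRoot (qPoly Λ n a)) (i j : ℕ)
    (h : ((x * y - 1) * x) • (f ⊗ₜ[Λ] (AdjoinRoot.root _ * g) + (AdjoinRoot.root _ * g) ⊗ₜ[Λ] f) -
        ((x * y - 1) * y) • ((AdjoinRoot.root _ * f) ⊗ₜ[Λ] g + g ⊗ₜ[Λ] (AdjoinRoot.root _ * f)) =
      ((x - y) * (x * y)) • ((f * g) ⊗ₜ[Λ] AdjoinRoot.root _ + AdjoinRoot.root _ ⊗ₜ[Λ] (f * g)) -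
        (x - y) • ((AdjoinRoot.root _ * (f * g)) ⊗ₜ[Λ] 1 +
          (1 : AdjoinRoot (qPoly Λ n a)) ⊗ₜ[Λ] (AdjoinRoot.root _ * (f * g)))) :
    let l := tilCoord n a
    let u := AdjoinRoot.root (qPoly Λ n a)
    (x * y - 1) * (x * (l i f * l j (u * g) + l j f * l i (u * g)) -
        y * (l i (u * f) * l j g + l j (u * f) * l i g)) =
      (x - y) * (x * y * (l i (f * g) * l j u + l j (f * g) * l i u) -
        (l i (u * (f * g)) * l j 1 + l j (u * (f * g)) * l i 1)) := by
  have h' := congrArg (LinearMap.mul' Λ Λ ∘ₗ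
    TensorProduct.map (tilCoord n a i) (tilCoord n a j)) h
  simp only [map_add, map_sub, map_smul, LinearMap.comp_apply, TensorProduct.map_tmul,
    LinearMap.mul'_apply, smul_eq_mul] at h'
  linear_combination h'

end Coordinates

section Representation
open Polynomial Matrix

/-- A representation of `H_p` in a `Λ`-algebra, extended along a map of rational functions. -/
lemma exists_representation {k : Type} [Field k] {z : Type} [CommRing z] [Algebra k z]
    {F Λ M : Type} [CommRing F] [Algebra k F] [CommRing Λ] [Ring M] [Algebra Λ M]
    (ω : z) (n : ℕ) (A : ℕ → z) (σ : F →+* Λ) (τ : z →+* Λ)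
    (hστ : ∀ c : k, σ (algebraMap k F c) = τ (algebraMap k z c)) (Rm Km : M)
    (hR : Rm * Rm = τ ω • Rm + 1) (hRK : Rm * Km * Rm * Km = Km * Rm * Km * Rm)
    (hK : -Km ^ (n + 1) + ∑ i ∈ Finset.range (n + 1), τ (A i) • Km ^ (n - i) = 0) :
    ∃ Ψ : F ⊗[k] Hp z ω n A →+* M,
      (∀ s, Ψ (s ⊗ₜ 1) = algebraMap Λ M (σ s)) ∧
      (∀ a, Ψ (1 ⊗ₜ algebraMap z (Hp z ω n A) a) = algebraMap Λ M (τ a)) ∧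
      Ψ (1 ⊗ₜ Rp z ω n A) = Rm ∧ Ψ (1 ⊗ₜ Kp z ω n A) = Km := by
  let : Algebra z M := Algebra.compHom M τ
  let : Algebra k M := Algebra.compHom M (τ.comp (algebraMap k z))
  let : Algebra F M := Algebra.compHom M σ
  have hz : ∀ (a : z) (m : M), a • m = τ a • m := fun _ _ => rfl
  have : IsScalarTower k z M := IsScalarTower.of_algebraMap_eq fun c => rfl
  have : IsScalarTower k F M := IsScalarTower.of_algebraMap_eq fun c =>
    congrArg (algebraMap Λ M) (hστ c).symm
  let free : FreeAlgebra z G →ₐ[z] M :=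
    FreeAlgebra.lift z fun g => match g with | G.R => Rm | G.K => Km
  have fR : free (FreeAlgebra.ι z G.R) = Rm := FreeAlgebra.lift_ι_apply _ _
  have fK : free (FreeAlgebra.ι z G.K) = Km := FreeAlgebra.lift_ι_apply _ _
  let h1 : H z ω →ₐ[z] M := RingQuot.liftAlgHom z ⟨free, fun a b hab => by
    cases hab with
    | hecke => simp only [map_mul, map_add, map_smul, map_one, fR, hz, hR]
    | re => simp only [map_mul, fR, fK, hRK]⟩
  have h1R : h1 (Rg z ω) = Rm := (RingQuot.liftAlgHom_mkAlgHom_apply _ _ _ _).trans fR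
  have h1K : h1 (Kg z ω) = Km := (RingQuot.liftAlgHom_mkAlgHom_apply _ _ _ _).trans fK
  let h2 : Hp z ω n A →ₐ[z] M := RingQuot.liftAlgHom z ⟨h1, fun a b hab => by
    cases hab with
    | mk => simp only [pKelt, map_add, map_neg, map_pow, map_sum, map_smul, map_zero, h1K, hz, hK]⟩
  have h2R : h2 (Rp z ω n A) = Rm := (RingQuot.liftAlgHom_mkAlgHom_apply _ _ _ _).trans h1R
  have h2K : h2 (Kp z ω n A) = Km := (RingQuot.liftAlgHom_mkAlgHom_apply _ _ _ _).trans h1K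
  let Ψ : F ⊗[k] Hp z ω n A →ₐ[F] M := Algebra.TensorProduct.lift (Algebra.ofId F M)
    (h2.restrictScalars k) fun s b => Algebra.commutes _ _
  have hΨ : ∀ s b, Ψ (s ⊗ₜ b) = algebraMap Λ M (σ s) * h2 b :=
    fun s b => Algebra.TensorProduct.lift_tmul _ _ _ s b
  refine ⟨Ψ.toRingHom, fun s => (hΨ _ _).trans ?_, fun a => (hΨ _ _).trans ?_,
    (hΨ _ _).trans ?_, (hΨ _ _).trans ?_⟩
  · rw [map_one h2, mul_one]
  · rw [map_one, map_one, one_mul]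
    exact h2.commutes a
  · rw [map_one, map_one, one_mul, h2R]
  · rw [map_one, map_one, one_mul, h2K]

/-- The image of `R` in the two-dimensional representation of the affine Hecke algebra. -/
def matR {T : Type} [CommRing T] (w : T) : Matrix (Fin 2) (Fin 2) T := !![0, 1; 1, w]

/-- The image of `K` in the two-dimensional representation of the affine Hecke algebra. -/
def matK {T : Type} [CommRing T] (w K Y : T) : Matrix (Fin 2) (Fin 2) T := !![K, -(w * Y); 0, Y]

lemma matR_mul_self {T : Type} [CommRing T] (w : T) :
    matR w * matR w = w • matR w + 1 := by
  ext i j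
  fin_cases i <;> fin_cases j <;> simp [matR, Matrix.mul_apply, Fin.sum_univ_two, add_comm]

lemma matR_matK_reflection {T : Type} [CommRing T] (w K Y : T) :
    matR w * matK w K Y * matR w * matK w K Y = matK w K Y * matR w * matK w K Y * matR w := by
  ext i j
  fin_cases i <;> fin_cases j <;>
    simp [matR, matK, Matrix.mul_apply, Fin.sum_univ_two] <;> ring

lemma exists_aeval_matK {R T : Type} [CommRing R] [CommRing T] [Algebra R T] (w K Y : T)
    (f : R[X]) : ∃ δ : T, aeval (matK w K Y) f =
        !![aeval K f, -(w * Y * δ); 0, aeval Y f] ∧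
      (Y - K) * δ = aeval Y f - aeval K f := by
  induction f using Polynomial.induction_on' with
  | add f g hf hg =>
    obtain ⟨δ, h1, h2⟩ := hf
    obtain ⟨ε, h3, h4⟩ := hg
    refine ⟨δ + ε, ?_, by rw [map_add, map_add]; linear_combination h2 + h4⟩
    rw [map_add, h1, h3]
    ext i j
    fin_cases i <;> fin_cases j <;> simp; ring
  | monomial m a =>
    have hpow : ∃ δ : T, matK w K Y ^ m = !![K ^ m, -(w * Y * δ); 0, Y ^ m] ∧
        (Y - K) * δ = Y ^ m - K ^ m := by
      induction m with
      | zero => exact ⟨0, by ext i j; fin_cases i <;> fin_cases j <;> simp, by simp⟩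
      | succ m ih =>
        obtain ⟨δ, h1, h2⟩ := ih
        refine ⟨K ^ m + δ * Y, ?_, by linear_combination Y * h2⟩
        rw [pow_succ, h1]
        ext i j
        fin_cases i <;> fin_cases j <;>
          simp [matK, Matrix.mul_apply, Fin.sum_univ_two] <;> ring
    obtain ⟨δ, h1, h2⟩ := hpow
    refine ⟨algebraMap R T a * δ, ?_, ?_⟩
    · rw [aeval_monomial, h1, ← Algebra.smul_def, aeval_monomial, aeval_monomial]
      ext i j
      fin_cases i <;> fin_cases j <;> simp [Algebra.smul_def]; ring
    · rw [aeval_monomial, aeval_monomial]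
      linear_combination algebraMap R T a * h2

/-- The upper left entry of the reflection equation in the two-dimensional representation. -/
lemma reflection_matrix_entry {T : Type} [CommRing T] (w Y s t f₁ f₂ δ g₁ g₂ ε : T)
    (h : (matR w - s • (matR w - w • 1)) * !![f₁, -(w * Y * δ); 0, f₂] *
        (matR w - t • (matR w - w • 1)) * !![g₁, -(w * Y * ε); 0, g₂] =
      !![g₁, -(w * Y * ε); 0, g₂] * (matR w - t • (matR w - w • 1)) *
        !![f₁, -(w * Y * δ); 0, f₂] * (matR w - s • (matR w - w • 1))) :
    w * w * Y * ((1 - s) * (1 - t) * (f₂ - Y * δ) * ε +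
      (1 - s) * t * (ε * f₂ + δ * g₁) + (1 - t) * s * (ε * f₁ - δ * g₁)) = 0 := by
  have hR : ∀ r : T, matR w - r • (matR w - w • 1) = !![r * w, 1 - r; 1 - r, w] := by
    intro r
    ext i j
    fin_cases i <;> fin_cases j <;> simp [matR]
  have h00 := congrFun (congrFun h 0) 0
  rw [hR, hR] at h00
  simp [Matrix.mul_apply, Fin.sum_univ_two] at h00
  linear_combination h00

/-- In the two-dimensional representation over a commutative algebra in which `Y - K` kills the
kernel of reduction, the reflection equation becomes symmetric in `K` and `Y`. -/
lemma symmetric_equation_of_annihilated {T Λ : Type} [CommRing T] [Field Λ] [Algebra Λ T]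
    (x y : Λ) (hx : x ≠ 0) (hy : y ≠ 0) (K Y f₁ f₂ δ g₁ g₂ ε : T)
    (hδ : (Y - K) * δ = f₂ - f₁) (hε : (Y - K) * ε = g₂ - g₁)
    (h : (Y - K) * ((1 - algebraMap Λ T (y / x)) * (1 - algebraMap Λ T (x * y)⁻¹) *
        (f₂ - Y * δ) * ε +
      (1 - algebraMap Λ T (y / x)) * algebraMap Λ T (x * y)⁻¹ * (ε * f₂ + δ * g₁) +
      (1 - algebraMap Λ T (x * y)⁻¹) * algebraMap Λ T (y / x) * (ε * f₁ - δ * g₁)) = 0) :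
    ((x * y - 1) * x) • (f₁ * (Y * g₂) + (K * g₁) * f₂) -
        ((x * y - 1) * y) • ((K * f₁) * g₂ + g₁ * (Y * f₂)) =
      ((x - y) * (x * y)) • (f₁ * g₁ * Y + K * (f₂ * g₂)) -
        (x - y) • (K * (f₁ * g₁) + Y * (f₂ * g₂)) := by
  obtain ⟨x', hx'⟩ : ∃ x' : T, x' = algebraMap Λ T x := ⟨_, rfl⟩
  obtain ⟨y', hy'⟩ : ∃ y' : T, y' = algebraMap Λ T y := ⟨_, rfl⟩
  have hs : x' * algebraMap Λ T (y / x) = y' := by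
    rw [hx', hy', ← map_mul, mul_div_cancel₀ _ hx]
  have ht : x' * y' * algebraMap Λ T (x * y)⁻¹ = 1 := by
    rw [hx', hy', ← map_mul, ← map_mul, mul_inv_cancel₀ (mul_ne_zero hx hy), map_one]
  generalize algebraMap Λ T (y / x) = s at *
  generalize algebraMap Λ T (x * y)⁻¹ = t at *
  have h' : (Y - K) * ((x' - y') * (x' * y' - 1) * (f₂ - Y * δ) * ε +
      (x' - y') * (ε * f₂ + δ * g₁) + (x' * y' - 1) * y' * (ε * f₁ - δ * g₁)) = 0 := by
    have e₁ : (1 - s) * (1 - t) * (x' ^ 2 * y') = (x' - y') * (x' * y' - 1) := by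
      linear_combination -(x' * y' - x' * y' * t) * hs - (x' - y') * ht
    have e₂ : (1 - s) * t * (x' ^ 2 * y') = x' - y' := by
      linear_combination -(x' * y' * t) * hs + (x' - y') * ht
    have e₃ : (1 - t) * s * (x' ^ 2 * y') = (x' * y' - 1) * y' := by
      linear_combination (x' * y' - x' * y' * t) * hs - y' * ht
    rw [← e₁, ← e₂, ← e₃]
    linear_combination x' ^ 2 * y' * h
  simp only [Algebra.smul_def, map_mul, map_sub, map_one, ← hx', ← hy']
  linear_combination (Y - K) * h' -
    (-((x' - y') * (x' * y' - 1)) * Y * (g₂ - g₁) + (Y - K) * (x' - y') * g₁ -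
      (Y - K) * (x' * y' - 1) * y' * g₁) * hδ -
    ((x' - y') * (x' * y' - 1) * (Y - K) * (f₂ - Y * δ) + (Y - K) * (x' - y') * f₂ +
      (Y - K) * (x' * y' - 1) * y' * f₁) * hε

end Representation

section TensorEquation
open Polynomial Matrix

lemma aeval_matK_map {Λ T Q : Type} [CommRing Λ] [CommRing T] [CommRing Q] [Algebra Λ T]
    [Algebra Λ Q] (π : T →ₐ[Λ] Q) (w K Y : T) (f : Λ[X]) :
    aeval (matK (π w) (π K) (π Y)) f = (aeval (matK w K Y) f).map π := by
  have h : matK (π w) (π K) (π Y) = π.mapMatrix (matK w K Y) := by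
    ext i j
    fin_cases i <;> fin_cases j <;> simp [matK]
  rw [h, aeval_algHom_apply]
  rfl

/-- The reflection equation in the two-dimensional representations of `H_p` implies a scalar
equation in `Λ[u]/(p) ⊗ Λ[u]/(p)`. -/
lemma tensor_equation_of_reflection {Λ : Type} [Field Λ] (n : ℕ) (a : ℕ → Λ) (ha : a n ≠ 0)
    (w x y : Λ) (hw : w ≠ 0) (hx : x ≠ 0) (hy : y ≠ 0) (f g : Λ[X])
    (h : ∀ (Q : Type) [CommRing Q] [Algebra Λ Q] (K Y : Q),
      aeval (matK (algebraMap Λ Q w) K Y) (qPoly Λ n a) = 0 →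
      let R := matR (algebraMap Λ Q w)
      let F := aeval (matK (algebraMap Λ Q w) K Y) f
      let G := aeval (matK (algebraMap Λ Q w) K Y) g
      let Rs := R - algebraMap Λ Q (y / x) • (R - algebraMap Λ Q w • 1)
      let Rt := R - algebraMap Λ Q (x * y)⁻¹ • (R - algebraMap Λ Q w • 1)
      Rs * F * Rt * G = G * Rt * F * Rs) :
    let u := AdjoinRoot.root (qPoly Λ n a)
    let f' := AdjoinRoot.mk (qPoly Λ n a) f
    let g' := AdjoinRoot.mk (qPoly Λ n a) g
    ((x * y - 1) * x) • (f' ⊗ₜ[Λ] (u * g') + (u * g') ⊗ₜ[Λ] f') -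
        ((x * y - 1) * y) • ((u * f') ⊗ₜ[Λ] g' + g' ⊗ₜ[Λ] (u * f')) =
      ((x - y) * (x * y)) • ((f' * g') ⊗ₜ[Λ] u + u ⊗ₜ[Λ] (f' * g')) -
        (x - y) • ((u * (f' * g')) ⊗ₜ[Λ] 1 +
          (1 : AdjoinRoot (qPoly Λ n a)) ⊗ₜ[Λ] (u * (f' * g'))) := by
  intro u f' g'
  let T := AdjoinRoot (qPoly Λ n a) ⊗[Λ] AdjoinRoot (qPoly Λ n a)
  let K : T := u ⊗ₜ 1
  let Y : T := 1 ⊗ₜ u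
  have hK : ∀ r : Λ[X], aeval K r = AdjoinRoot.mk (qPoly Λ n a) r ⊗ₜ 1 := fun r => by
    rw [← AdjoinRoot.aeval_eq]
    exact aeval_algHom_apply (Algebra.TensorProduct.includeLeft : _ →ₐ[Λ] T) _ r
  have hY : ∀ r : Λ[X], aeval Y r = 1 ⊗ₜ AdjoinRoot.mk (qPoly Λ n a) r := fun r => by
    rw [← AdjoinRoot.aeval_eq]
    exact aeval_algHom_apply (Algebra.TensorProduct.includeRight : _ →ₐ[Λ] T) _ r
  obtain ⟨Y', hY'⟩ : ∃ Y' : T, Y' * Y = algebraMap Λ T (a n) := by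
    refine ⟨aeval Y (qPoly Λ n a).divX, ?_⟩
    have h0 := congrArg (aeval Y) (divX_mul_X_add (qPoly Λ n a))
    rw [qPoly_coeff n a 0 (Nat.zero_le n), hY (qPoly Λ n a), AdjoinRoot.mk_self,
      TensorProduct.tmul_zero, map_add, map_mul, aeval_X, aeval_C, map_neg, Nat.sub_zero] at h0
    linear_combination h0
  let w' := algebraMap Λ T w
  obtain ⟨δ, hFδ, hδ⟩ := exists_aeval_matK w' K Y f
  obtain ⟨ε, hGε, hε⟩ := exists_aeval_matK w' K Y g
  obtain ⟨d, hPd, hd⟩ := exists_aeval_matK w' K Y (qPoly Λ n a)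
  rw [hK (qPoly Λ n a), hY (qPoly Λ n a), AdjoinRoot.mk_self, TensorProduct.tmul_zero,
    TensorProduct.zero_tmul] at hPd hd
  let π := Ideal.Quotient.mkₐ Λ (Ideal.span {d})
  have hπd : π d = 0 := Ideal.Quotient.eq_zero_iff_mem.2 (Ideal.mem_span_singleton_self d)
  have hπ : ∀ c, algebraMap Λ _ c = π (algebraMap Λ T c) := fun c => (π.commutes c).symm
  have key := h (T ⧸ Ideal.span {d}) (π K) (π Y) (by
    rw [hπ, aeval_matK_map, hPd]
    ext i j
    fin_cases i <;> fin_cases j <;> simp [hπd])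
  have hmap : ∀ p q r : T, Matrix.map !![p, -(w' * Y * q); 0, r] π =
      !![π p, -(π w' * π Y * π q); 0, π r] := fun p q r => by
    ext i j
    fin_cases i <;> fin_cases j <;> simp
  simp only [hπ] at key
  rw [aeval_matK_map, aeval_matK_map, hFδ, hGε, hmap, hmap] at key
  have key := reflection_matrix_entry _ _ _ _ _ _ _ _ _ _ key
  rw [hK, hY] at hδ hε hFδ hGε
  have hS : π ((1 - algebraMap Λ T (y / x)) * (1 - algebraMap Λ T (x * y)⁻¹) *
        (aeval Y f - Y * δ) * ε +
      (1 - algebraMap Λ T (y / x)) * algebraMap Λ T (x * y)⁻¹ * (ε * aeval Y f + δ * aeval K g) +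
      (1 - algebraMap Λ T (x * y)⁻¹) * algebraMap Λ T (y / x) *
        (ε * aeval K f - δ * aeval K g)) = 0 := by
    have hunit : IsUnit (algebraMap Λ (T ⧸ Ideal.span {d}) (w * w * a n)) :=
      (IsUnit.mk0 _ (mul_ne_zero (mul_ne_zero hw hw) ha)).map _
    rw [← hunit.mul_right_eq_zero, hπ, map_mul, map_mul, ← hY']
    simp only [map_mul, map_add, map_sub, map_one] at key ⊢
    linear_combination π Y' * key
  obtain ⟨t, ht⟩ := Ideal.mem_span_singleton'.1 (Ideal.Quotient.eq_zero_iff_mem.1 hS)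
  have hsym := symmetric_equation_of_annihilated x y hx hy K Y (f' ⊗ₜ 1) (1 ⊗ₜ f') δ
    (g' ⊗ₜ 1) (1 ⊗ₜ g') ε hδ hε (by
      rw [hK, hK, hY] at ht
      rw [← ht]
      linear_combination t * hd)
  have hmul : ∀ p q r s, (p ⊗ₜ q : T) * (r ⊗ₜ s : T) = ((p * r) ⊗ₜ (q * s) : T) :=
    fun p q r s => Algebra.TensorProduct.tmul_mul_tmul p r q s
  simpa only [K, Y, hmul, one_mul, mul_one] using hsym

end TensorEquation

section Denominators
open Polynomial

variable {k : Type} [Field k] {z : Type} [CommRing z] [Algebra k z]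
  {B : Type} [Ring B] [Algebra k B] [Algebra z B] [IsScalarTower k z B]

/-- Polynomials over `z`, viewed as scalars of `B(x)`. -/
def scalarHom (k : Type) [Field k] (z : Type) [CommRing z] [Algebra k z]
    (B : Type) [Ring B] [Algebra k B] [Algebra z B] [IsScalarTower k z B] :
    z[X] →+* RatFunc k ⊗[k] B :=
  (Algebra.TensorProduct.map (AlgHom.id k (RatFunc k))
    ((Algebra.ofId z B).restrictScalars k)).toRingHom.comp
    (eval₂RingHom (Algebra.TensorProduct.includeRight : z →ₐ[k] RatFunc k ⊗[k] z).toRingHom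
      (RatFunc.X ⊗ₜ 1))

lemma scalarHom_C (a : z) : scalarHom k z B (C a) = 1 ⊗ₜ algebraMap z B a := by
  simp [scalarHom, Algebra.ofId_apply]

lemma scalarHom_X : scalarHom k z B X = RatFunc.X ⊗ₜ 1 := by
  simp [scalarHom]

lemma scalarHom_map_mul (r : k[X]) (t : RatFunc k ⊗[k] B) :
    scalarHom k z B (r.map (algebraMap k z)) * t = algebraMap k[X] (RatFunc k) r • t := by
  have h : (scalarHom k z B).comp (mapRingHom (algebraMap k z)) =
      (algebraMap (RatFunc k) (RatFunc k ⊗[k] B)).comp (algebraMap k[X] (RatFunc k)) := by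
    refine ringHom_ext (fun a => ?_) ?_
    · simp only [RingHom.comp_apply, coe_mapRingHom, map_C, scalarHom_C]
      rw [← IsScalarTower.algebraMap_apply k z B, Algebra.TensorProduct.algebraMap_apply,
        RatFunc.algebraMap_C, ← RatFunc.algebraMap_eq_C, Algebra.algebraMap_eq_smul_one (A := B),
        Algebra.algebraMap_eq_smul_one (A := RatFunc k), ← TensorProduct.smul_tmul, algebraMap_smul]
    · simp [scalarHom_X, Algebra.TensorProduct.algebraMap_apply]
  rw [Algebra.smul_def]
  exact congrArg (· * t) (RingHom.congr_fun h r)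

lemma phiT_eq_scalarHom (ξ : z) (A : ℕ → z) (i : ℕ) :
    phiT k z (B := B) ξ A i = scalarHom k z B (phiP z A ξ i) := by
  induction i with
  | zero => simp [phiT, phiP]
  | succ i ih => simp [phiT, phiP, ih, scalarHom_C, scalarHom_X]

lemma IsScalarElt.exists_smul_eq {c : RatFunc k ⊗[k] B} (hc : IsScalarElt k z c) :
    ∃ (r : k[X]) (P : z[X]), r ≠ 0 ∧ algebraMap k[X] (RatFunc k) r • c = scalarHom k z B P := by
  induction hc using Submodule.span_induction with
  | mem c h =>
    obtain ⟨a, rfl⟩ := h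
    exact ⟨1, C a, one_ne_zero, by simp [scalarHom_C]⟩
  | zero => exact ⟨1, 0, one_ne_zero, by simp⟩
  | add c d _ _ hc hd =>
    obtain ⟨r, P, hr, h1⟩ := hc
    obtain ⟨s, Q, hs, h2⟩ := hd
    refine ⟨r * s, s.map (algebraMap k z) * P + r.map (algebraMap k z) * Q,
      mul_ne_zero hr hs, ?_⟩
    rw [map_add, map_mul, map_mul (scalarHom k z B), map_mul (scalarHom k z B),
      scalarHom_map_mul, scalarHom_map_mul,
      ← h1, ← h2, smul_smul, smul_smul, smul_add, mul_comm (algebraMap _ _ s)]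
  | smul q c _ hc =>
    obtain ⟨r, P, hr, h1⟩ := hc
    refine ⟨q.denom * r, q.num.map (algebraMap k z) * P, mul_ne_zero q.denom_ne_zero hr, ?_⟩
    have hq : algebraMap k[X] (RatFunc k) q.denom * q = algebraMap k[X] (RatFunc k) q.num := by
      have := RatFunc.num_div_denom q
      rw [div_eq_iff (RatFunc.algebraMap_ne_zero q.denom_ne_zero)] at this
      rw [this, mul_comm]
    rw [map_mul (scalarHom k z B), scalarHom_map_mul, ← h1, smul_smul, smul_smul, ← hq, map_mul]
    congr 1
    ring

lemma exists_common_denominator (f : ℕ → RatFunc k ⊗[k] B) (hf : ∀ i, IsScalarElt k z (f i))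
    (N : ℕ) : ∃ (r : k[X]) (D : ℕ → z[X]), r ≠ 0 ∧
      ∀ i ≤ N, algebraMap k[X] (RatFunc k) r • f i = scalarHom k z B (D i) := by
  choose r P hr hP using fun i => (hf i).exists_smul_eq
  refine ⟨∏ i ∈ Finset.range (N + 1), r i,
    fun i => (∏ j ∈ (Finset.range (N + 1)).erase i, r j).map (algebraMap k z) * P i,
    Finset.prod_ne_zero_iff.2 fun i _ => hr i, fun i hi => ?_⟩
  rw [map_mul (scalarHom k z B), scalarHom_map_mul, ← hP, smul_smul, ← map_mul,
    Finset.prod_erase_mul _ _ (Finset.mem_range.2 (Nat.lt_succ_of_le hi))]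

end Denominators

section TwoVariables
open Polynomial

variable {k : Type} [Field k] {z : Type} [Field z]

lemma embP_X_zero : embP k 0 X = xvar k := by simp [embP, xvar]

lemma embP_X_one : embP k 1 X = yvar k := by simp [embP, yvar]

lemma emb_X (i : Fin 2) : emb k i RatFunc.X = embP k i X := by
  have h := RatFunc.liftAlgHom_apply_div (embP k i)
    (nonZeroDivisors_le_comap_nonZeroDivisors_of_injective _ (embP_injective k i)) X 1
  rwa [map_one, div_one, map_one, div_one, RatFunc.algebraMap_X] at h

lemma xvar_sub_yvar_ne_zero : xvar z - yvar z ≠ 0 := by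
  rw [sub_ne_zero]
  exact (IsFractionRing.injective (P2 z) (F2 z)).ne (MvPolynomial.X_injective.ne (by decide))

lemma xvar_mul_yvar_sub_one_ne_zero : xvar z * yvar z - 1 ≠ 0 := by
  rw [xvar, yvar, ← map_mul, ← map_one (algebraMap (P2 z) (F2 z)), sub_ne_zero]
  refine (IsFractionRing.injective (P2 z) (F2 z)).ne fun h => ?_
  have := congrArg MvPolynomial.constantCoeff h
  simp at this

lemma eq_C_mul_of_embP_mul_eq (U V : z[X])
    (h : embP z 0 U * embP z 1 V = embP z 1 U * embP z 0 V) (hV : V ≠ 0) :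
    ∃ c : z, U = C c * V := by
  have h1 : aeval (MvPolynomial.X 0 : P2 z) U * aeval (MvPolynomial.X 1 : P2 z) V =
      aeval (MvPolynomial.X 1 : P2 z) U * aeval (MvPolynomial.X 0 : P2 z) V := by
    apply IsFractionRing.injective (P2 z) (F2 z)
    rw [map_mul, map_mul]
    exact h
  have h2 := congrArg (MvPolynomial.aeval (R := z) ![C X, (X : z[X][X])]) h1
  have e0 : ∀ P : z[X], aeval (C X : z[X][X]) P = C P := fun P => by
    have := aeval_algHom_apply (CAlgHom (R := z) (A := z[X])) X P
    simpa using this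
  have e1 : ∀ P : z[X], aeval (X : z[X][X]) P = P.map C := fun P => by
    exact (eval₂_map C C X).symm.trans eval₂_C_X
  simp only [map_mul, ← aeval_algHom_apply, MvPolynomial.aeval_X, Matrix.cons_val_zero,
    Matrix.cons_val_one, e0, e1] at h2
  have h3 := congrArg (fun P => P.coeff V.natDegree) h2
  simp only [coeff_C_mul, coeff_mul_C, coeff_map] at h3
  refine ⟨U.coeff V.natDegree / V.leadingCoeff, ?_⟩
  have hl : C V.leadingCoeff ≠ 0 := C_ne_zero.2 (leadingCoeff_ne_zero.2 hV)
  refine mul_right_cancel₀ hl ?_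
  rw [coeff_natDegree] at h3
  rw [h3, mul_right_comm, ← C_mul, div_mul_cancel₀ _ (leadingCoeff_ne_zero.2 hV)]

variable [Algebra k z]

/-- The base change map `k(x,y) → z(x,y)`. -/
def baseChange (k : Type) [Field k] (z : Type) [Field z] [Algebra k z] : F2 k →+* F2 z :=
  IsFractionRing.map (A := P2 k) (B := P2 z) (j := MvPolynomial.map (algebraMap k z))
    (MvPolynomial.map_injective _ (algebraMap k z).injective)

lemma baseChange_algebraMap (p : P2 k) : baseChange k z (algebraMap (P2 k) (F2 k) p) =
    algebraMap (P2 z) (F2 z) (MvPolynomial.map (algebraMap k z) p) :=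
  IsLocalization.map_eq (M := nonZeroDivisors (P2 k)) (T := nonZeroDivisors (P2 z))
    (nonZeroDivisors_le_comap_nonZeroDivisors_of_injective _
      (MvPolynomial.map_injective _ (algebraMap k z).injective)) p

lemma baseChange_const (c : k) : baseChange k z (algebraMap k (F2 k) c) =
    algebraMap z (F2 z) (algebraMap k z c) := by
  rw [IsScalarTower.algebraMap_apply k (P2 k) (F2 k), baseChange_algebraMap,
    MvPolynomial.algebraMap_eq, MvPolynomial.map_C, IsScalarTower.algebraMap_apply z (P2 z) (F2 z),
    MvPolynomial.algebraMap_eq]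

lemma baseChange_embP_X (i : Fin 2) : baseChange k z (embP k i X) = embP z i X := by
  simp [embP, baseChange_algebraMap]

end TwoVariables

section Reflection
open Polynomial Matrix

variable {k : Type} [Field k] {z : Type} [CommRing z] [Algebra k z]

lemma map_iota_scalarHom {B M Λ : Type} [Ring B] [Algebra k B] [Algebra z B] [IsScalarTower k z B]
    [Ring M] [CommRing Λ] [Algebra Λ M] (σ : F2 k →+* Λ) (τ : z →+* Λ) (Ψ : F2 k ⊗[k] B →+* M)
    (hs : ∀ s, Ψ (s ⊗ₜ 1) = algebraMap Λ M (σ s))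
    (ha : ∀ a, Ψ (1 ⊗ₜ algebraMap z B a) = algebraMap Λ M (τ a))
    (i : Fin 2) (e : z[X] →+* Λ) (heC : ∀ a, e (C a) = τ a) (heX : e X = σ (embP k i X))
    (P : z[X]) : Ψ (iota k i (scalarHom k z B P)) = algebraMap Λ M (e P) := by
  have h : Ψ.comp ((iota k i).toRingHom.comp (scalarHom k z B)) = (algebraMap Λ M).comp e := by
    refine ringHom_ext (fun a => ?_) ?_
    · change Ψ (iota k i (scalarHom k z B (C a))) = algebraMap Λ M (e (C a))
      rw [scalarHom_C, iota, Algebra.TensorProduct.map_tmul, map_one, AlgHom.id_apply, ha, heC]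
    · change Ψ (iota k i (scalarHom k z B X)) = algebraMap Λ M (e X)
      rw [scalarHom_X, iota, Algebra.TensorProduct.map_tmul, map_one, emb_X, hs, heX]
  exact RingHom.congr_fun h P

/-- The polynomial in `u` with coordinates `d 0, …, d n` in the basis `1, u, …, u^(n-1), ũ`. -/
def solPoly {Λ : Type} [CommRing Λ] (n : ℕ) (a d : ℕ → Λ) : Λ[X] :=
  ∑ j ∈ Finset.range n, C (d j) * X ^ j + C (d n) *
    (X ^ n - ∑ j ∈ Finset.range n, C (a j) * X ^ (n - 1 - j))

/-- A solution of the reflection equation, cleared of denominators, yields solutions in the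
two-dimensional representations of the affine Hecke algebra that factor through `H_p`. -/
lemma reflection_of_isSol {Λ : Type} [Field Λ] (ωk : k) (ω : z) (hω : ω = algebraMap k z ωk)
    (n : ℕ) (A : ℕ → z) (c : RatFunc k ⊗[k] Hp z ω n A) (hc : IsSol k ωk (Rp z ω n A) c)
    (r : RatFunc k) (D : ℕ → z[X]) (hD : r • c =
      ∑ j ∈ Finset.range n, scalarHom k z (Hp z ω n A) (D j) * (1 ⊗ₜ Kp z ω n A ^ j) +
        scalarHom k z (Hp z ω n A) (D n) * (1 ⊗ₜ Ktil z ω n A))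
    (σ : F2 k →+* Λ) (τ : z →+* Λ)
    (hστ : ∀ c : k, σ (algebraMap k (F2 k) c) = τ (algebraMap k z c))
    (e : Fin 2 → z[X] →+* Λ) (heC : ∀ i a, e i (C a) = τ a)
    (heX : ∀ i, e i X = σ (embP k i X))
    (Q : Type) [CommRing Q] [Algebra Λ Q] (K Y : Q) :
    let w := algebraMap Λ Q (τ ω)
    aeval (matK w K Y) (qPoly Λ n fun i => τ (A i)) = 0 →
    let F := aeval (matK w K Y) (solPoly n (fun i => τ (A i)) fun j => e 0 (D j))
    let G := aeval (matK w K Y) (solPoly n (fun i => τ (A i)) fun j => e 1 (D j))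
    let Rs := matR w - algebraMap Λ Q (e 1 X / e 0 X) • (matR w - w • 1)
    let Rt := matR w - algebraMap Λ Q (e 0 X * e 1 X)⁻¹ • (matR w - w • 1)
    Rs * F * Rt * G = G * Rt * F * Rs := by
  intro w hK F G Rs Rt
  obtain ⟨Ψ, hs, ha, hRp, hKp⟩ := exists_representation (M := Matrix (Fin 2) (Fin 2) Q) ω n A
    σ τ hστ (matR w) (matK w K Y)
    (by rw [matR_mul_self, algebraMap_smul]) (matR_matK_reflection w K Y) (by
      have h := neg_eq_zero.2 hK
      simp only [qPoly, map_sub, map_sum, map_mul, map_pow, aeval_X, aeval_C,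
        ← Algebra.smul_def] at h
      rw [← h]
      abel)
  have hsmul : ∀ s t, Ψ (s • t) = algebraMap Λ _ (σ s) * Ψ t := fun s t => by
    rw [Algebra.smul_def, map_mul, Algebra.TensorProduct.algebraMap_apply, ← hs]
    rfl
  have hpow : ∀ j, Ψ (1 ⊗ₜ (Kp z ω n A ^ j)) = matK w K Y ^ j := fun j => by
    rw [← hKp, ← map_pow, Algebra.TensorProduct.tmul_pow, one_pow]
  have hsol : ∀ i, Ψ (iota k i (r • c)) =
      aeval (matK w K Y) (solPoly n (fun i => τ (A i)) fun j => e i (D j)) := by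
    intro i
    have hi : ∀ b, iota k i (1 ⊗ₜ b) = (1 ⊗ₜ b : F2 k ⊗[k] Hp z ω n A) := fun b => by
      simp [iota]
    have htil : Ψ (1 ⊗ₜ Ktil z ω n A) = aeval (matK w K Y)
        (X ^ n - ∑ j ∈ Finset.range n, C (τ (A j)) * X ^ (n - 1 - j)) := by
      simp only [Ktil, TensorProduct.tmul_sub, TensorProduct.tmul_sum, map_sub, map_sum,
        map_mul, map_pow, aeval_X, aeval_C]
      rw [hpow]
      refine congrArg _ (Finset.sum_congr rfl fun j _ => ?_)
      rw [Algebra.smul_def, ← ha, ← hpow, ← map_mul, Algebra.TensorProduct.tmul_mul_tmul, one_mul]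
    rw [hD, solPoly]
    simp only [map_add, map_sum, map_mul, hi, htil,
      map_iota_scalarHom σ τ Ψ hs ha i (e i) (heC i) (heX i), aeval_C, aeval_X, map_pow, hKp]
  have hRx : ∀ t, Ψ (RxElt k ωk (Rp z ω n A) t) =
      matR w - algebraMap Λ Q (σ t⁻¹) • (matR w - w • 1) := by
    intro t
    rw [RxElt, map_sub, hsmul, TensorProduct.tmul_sub, map_sub, hRp,
      IsScalarTower.algebraMap_apply k z (Hp z ω n A), ha, ← hω, ← Algebra.smul_def,
      algebraMap_smul, Algebra.algebraMap_eq_smul_one (τ ω), algebraMap_smul]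
  have hiota : ∀ i, iota k i (r • c) = emb k i r • iota k i c := fun i => by
    rw [Algebra.smul_def, map_mul]
    refine Eq.trans ?_ (Algebra.smul_def (emb k i r) (iota k i c)).symm
    congr 1
  have key : RxElt k ωk (Rp z ω n A) (xvar k / yvar k) * iota k 0 (r • c) *
        RxElt k ωk (Rp z ω n A) (xvar k * yvar k) * iota k 1 (r • c) =
      iota k 1 (r • c) * RxElt k ωk (Rp z ω n A) (xvar k * yvar k) * iota k 0 (r • c) *
        RxElt k ωk (Rp z ω n A) (xvar k / yvar k) := by
    simp only [hiota, mul_smul_comm, smul_mul_assoc]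
    rw [smul_comm]
    exact congrArg _ (congrArg _ hc)
  have key := congrArg Ψ key
  have hx := heX 0
  have hy := heX 1
  rw [embP_X_zero] at hx
  rw [embP_X_one] at hy
  simp only [map_mul, hsol, hRx, inv_div, map_div₀, map_inv₀, ← hx, ← hy] at key
  simpa only [map_mul, map_div₀, map_inv₀] using key

end Reflection

section Assembly
open Polynomial

variable {k : Type} [Field k] {z : Type} [CommRing z] [Algebra k z]

lemma scalarHom_X_mul {B : Type} [Ring B] [Algebra k B] [Algebra z B] [IsScalarTower k z B]
    (P : z[X]) : scalarHom k z B (X * P) = (RatFunc.X : RatFunc k) • scalarHom k z B P := by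
  rw [map_mul, ← RatFunc.algebraMap_X, ← scalarHom_map_mul (z := z), map_X]

lemma tmul_Ktil (ω : z) (n : ℕ) (A : ℕ → z) : (1 : RatFunc k) ⊗ₜ[k] Ktil z ω n A =
    (1 ⊗ₜ Kp z ω n A) ^ n - ∑ j ∈ Finset.range n,
      scalarHom k z (Hp z ω n A) (C (A j)) * (1 ⊗ₜ Kp z ω n A) ^ (n - 1 - j) := by
  simp only [Ktil, TensorProduct.tmul_sub, TensorProduct.tmul_sum,
    Algebra.TensorProduct.tmul_pow, one_pow, scalarHom_C, Algebra.TensorProduct.tmul_mul_tmul,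
    one_mul, Algebra.smul_def]

lemma ratFunc_X_sub_inv (k : Type) [Field k] :
    ((RatFunc.X : RatFunc k) - RatFunc.X⁻¹)⁻¹ * RatFunc.X⁻¹ * (RatFunc.X ^ 2 - 1) = 1 := by
  have hX : (RatFunc.X : RatFunc k) ≠ 0 := RatFunc.X_ne_zero
  have h2 : (RatFunc.X : RatFunc k) ^ 2 - 1 ≠ 0 := by
    rw [← RatFunc.algebraMap_X, ← map_pow, ← map_one (algebraMap k[X] (RatFunc k)), ← map_sub]
    exact RatFunc.algebraMap_ne_zero (X_pow_sub_C_ne_zero two_pos 1)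
  rw [← mul_inv, sub_mul, inv_mul_cancel₀ hX, ← sq, inv_mul_cancel₀ h2]

lemma sum_mul_pow_eq {T : Type} [Ring T] (S : z[X] →+* T) (κ : T) (m : ℕ) (A : ℕ → z)
    (D φ : ℕ → z[X]) (hφ : φ 0 = 1)
    (h : ∀ i < m, D (m - i) - D (m + 1) * C (A i) = D (m + 1) * φ (i + 1)) :
    ∑ j ∈ Finset.range (m + 1), S (D j) * κ ^ j + S (D (m + 1)) * (κ ^ (m + 1) -
        ∑ j ∈ Finset.range (m + 1), S (C (A j)) * κ ^ (m - j)) =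
      S (D (m + 1)) * ∑ i ∈ Finset.range (m + 1), S (φ i) * κ ^ (m + 1 - i) +
        S (D 0 - D (m + 1) * C (A m)) := by
  have e : ∀ i ∈ Finset.range m, S (D (m - i)) * κ ^ (m - i) -
      S (D (m + 1)) * (S (C (A i)) * κ ^ (m - i)) =
      S (D (m + 1)) * (S (φ (i + 1)) * κ ^ (m - i)) := fun i hi => by
    rw [← mul_assoc, ← mul_assoc, ← map_mul, ← map_mul, ← h i (Finset.mem_range.1 hi), map_sub,
      sub_mul]
  rw [← Finset.sum_range_reflect, mul_sub, Finset.mul_sum, Finset.mul_sum,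
    Finset.sum_range_succ' (fun i => S (D (m + 1)) * (S (φ i) * κ ^ (m + 1 - i)))]
  simp only [Nat.add_sub_cancel, Nat.add_sub_add_right]
  rw [← Finset.sum_congr rfl e, Finset.sum_range_succ, Finset.sum_range_succ,
    Finset.sum_sub_distrib]
  simp only [hφ, map_one, map_sub, map_mul, Nat.sub_self, pow_zero, mul_one, one_mul,
    Nat.sub_zero]
  abel

/-- The coordinates of the principal baxterized element in the basis `1, K, …, K^(n-1), K̃`. -/
lemma eq_mul_KxMain (ω : z) (n : ℕ) (hn : 1 ≤ n) (A : ℕ → z) (ξ ζ : z)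
    (c g : RatFunc k ⊗[k] Hp z ω n A) (r : RatFunc k) (hr : r ≠ 0) (D : ℕ → z[X])
    (hD : r • c =
      ∑ j ∈ Finset.range n, scalarHom k z (Hp z ω n A) (D j) * (1 ⊗ₜ Kp z ω n A ^ j) +
        scalarHom k z (Hp z ω n A) (D n) * (1 ⊗ₜ Ktil z ω n A))
    (hg : r • g = scalarHom k z (Hp z ω n A) (D n))
    (h1 : ∀ i, i + 2 ≤ n → D (n - 1 - i) - D n * C (A i) = D n * phiP z A ξ (i + 1))
    (h0 : (X ^ 2 - 1) * (D 0 - D n * C (A (n - 1))) = D n * (C ζ * X - phiP z A ξ n)) :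
    c = g * KxMain k z ω n A ξ ζ := by
  obtain ⟨m, rfl⟩ : ∃ m, n = m + 1 := ⟨n - 1, by omega⟩
  set S := scalarHom k z (Hp z ω (m + 1) A) with hS
  have hlow : S (D (m + 1)) * (((RatFunc.X - RatFunc.X⁻¹)⁻¹ : RatFunc k) •
      (S (C ζ) - (RatFunc.X⁻¹ : RatFunc k) • S (phiP z A ξ (m + 1)))) =
      S (D 0 - D (m + 1) * C (A m)) := by
    have h := congrArg S h0
    have e1 : (X ^ 2 - 1) * (D 0 - D (m + 1) * C (A m)) =
      X * (X * (D 0 - D (m + 1) * C (A m))) - (D 0 - D (m + 1) * C (A m)) := by ring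
    have e2 : D (m + 1) * (C ζ * X - phiP z A ξ (m + 1)) =
      X * (D (m + 1) * C ζ) - D (m + 1) * phiP z A ξ (m + 1) := by ring
    rw [Nat.add_sub_cancel, e1, e2, map_sub, map_sub S (X * _), hS, scalarHom_X_mul,
      scalarHom_X_mul, scalarHom_X_mul, ← hS, smul_smul] at h
    have hX : (RatFunc.X : RatFunc k) ≠ 0 := RatFunc.X_ne_zero
    rw [mul_smul_comm, mul_sub, mul_smul_comm, ← map_mul, ← map_mul,
      ← inv_smul_smul₀ hX (S (D (m + 1) * C ζ)), ← smul_sub, ← h, smul_smul]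
    nth_rw 2 [← one_smul (RatFunc k) (S (D 0 - D (m + 1) * C (A m)))]
    rw [← sub_smul, smul_smul, ← sq, ratFunc_X_sub_inv, one_smul]
  refine smul_right_injective _ hr ?_
  change r • c = r • (g * _)
  rw [← smul_mul_assoc, hg, hD, KxMain, ← scalarHom_C, phiT_eq_scalarHom, mul_add, ← hS, hlow,
    tmul_Ktil]
  simp only [phiT_eq_scalarHom]
  refine Eq.trans ?_ (sum_mul_pow_eq S _ m A D (phiP z A ξ) rfl fun i hi => h1 i (by omega))
  simp only [Algebra.TensorProduct.tmul_pow, one_pow]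
  rfl

lemma IsPrincipal.exists_coordinates (ω : z) (n : ℕ) (hn : 2 ≤ n) (A : ℕ → z)
    (c : RatFunc k ⊗[k] Hp z ω n A) (hc : IsPrincipal k z ω n A c) :
    ∃ (g : RatFunc k ⊗[k] Hp z ω n A) (r : RatFunc k) (D : ℕ → z[X]),
      IsScalarElt k z g ∧ r ≠ 0 ∧ D (n - 1) ≠ 0 ∧ r • g = scalarHom k z (Hp z ω n A) (D n) ∧
      r • c = ∑ j ∈ Finset.range n, scalarHom k z (Hp z ω n A) (D j) * (1 ⊗ₜ Kp z ω n A ^ j) +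
        scalarHom k z (Hp z ω n A) (D n) * (1 ⊗ₜ Ktil z ω n A) := by
  obtain rfl | ⟨-, f, hf, rfl, hne⟩ := hc
  · omega
  obtain ⟨r, D, hr, hD⟩ := exists_common_denominator f hf n
  have hr' := RatFunc.algebraMap_ne_zero hr
  refine ⟨f n, algebraMap k[X] (RatFunc k) r, D, hf n, hr', fun h => hne ?_, hD n le_rfl, ?_⟩
  · have h1 := hD (n - 1) (Nat.sub_le n 1)
    rw [h, map_zero] at h1
    rw [← inv_smul_smul₀ hr' (f (n - 1)), h1, smul_zero]
  · rw [smul_add, Finset.smul_sum, ← smul_mul_assoc, hD n le_rfl]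
    refine congrArg (· + _) (Finset.sum_congr rfl fun j hj => ?_)
    rw [← smul_mul_assoc, hD j (Finset.mem_range.1 hj).le]

end Assembly

section Parameter
open Polynomial

lemma exists_parameter {z : Type} [Field z] [CharZero z] (n : ℕ) (hn : 2 ≤ n) (A : ℕ → z)
    (hA : A n ≠ 0) (ω : z) (hω : ω ≠ 0) (D : ℕ → z[X]) (hD : D (n - 1) ≠ 0)
    (h : ∀ (Q : Type) [CommRing Q] [Algebra (F2 z) Q] (K Y : Q),
      let w := algebraMap (F2 z) Q (algebraMap z (F2 z) ω)
      aeval (matK w K Y) (qPoly (F2 z) n fun i => algebraMap z (F2 z) (A i)) = 0 →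
      let F := aeval (matK w K Y)
        (solPoly n (fun i => algebraMap z (F2 z) (A i)) fun j => embP z 0 (D j))
      let G := aeval (matK w K Y)
        (solPoly n (fun i => algebraMap z (F2 z) (A i)) fun j => embP z 1 (D j))
      let Rs := matR w - algebraMap (F2 z) Q (embP z 1 X / embP z 0 X) • (matR w - w • 1)
      let Rt := matR w - algebraMap (F2 z) Q (embP z 0 X * embP z 1 X)⁻¹ • (matR w - w • 1)
      Rs * F * Rt * G = G * Rt * F * Rs) :
    ∃ ξ, ξ ≠ 0 ∧
      (∀ i, i + 2 ≤ n → D (n - 1 - i) - D n * C (A i) = D n * phiP z A ξ (i + 1)) ∧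
      (X ^ 2 - 1) * (D 0 - D n * C (A (n - 1))) = D n * (C (A n / ξ) * X - phiP z A ξ n) := by
  have : CharZero (F2 z) := charZero_of_injective_algebraMap (algebraMap z (F2 z)).injective
  have hτ := (algebraMap z (F2 z)).injective
  have hX : ∀ i, embP z i X ≠ 0 := fun i =>
    (map_ne_zero_iff _ (embP_injective z i)).2 X_ne_zero
  have hC : ∀ i a, embP z i (C a) = algebraMap z (F2 z) a := fun i a => (embP z i).commutes a
  set a : ℕ → F2 z := fun i => algebraMap z (F2 z) (A i) with ha
  have ht := tensor_equation_of_reflection n a ((map_ne_zero_iff _ hτ).2 hA)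
    (algebraMap z (F2 z) ω) (embP z 0 X) (embP z 1 X) ((map_ne_zero_iff _ hτ).2 hω) (hX 0) (hX 1)
    (solPoly n a fun j => embP z 0 (D j)) (solPoly n a fun j => embP z 1 (D j)) h
  have hco := fun i j => coordinates_of_tensor_equation n a _ _ _ _ i j ht
  set f := AdjoinRoot.mk (qPoly (F2 z) n a) (solPoly n a fun j => embP z 0 (D j)) with hf
  set g := AdjoinRoot.mk (qPoly (F2 z) n a) (solPoly n a fun j => embP z 1 (D j)) with hg
  set u := AdjoinRoot.root (qPoly (F2 z) n a) with hu
  let δ : ℕ → z[X] := fun i => if i = n then D (n - 1) else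
    if i = 0 then C (A n) * D n + C (A (n - 1)) * D (n - 1) else
      D (i - 1) + C (A (n - 1 - i)) * D (n - 1)
  have hn0 : n ≠ 0 := by omega
  have hδ0 : δ 0 = C (A n) * D n + C (A (n - 1)) * D (n - 1) := by
    simp [δ, hn0.symm]
  have hδ : ∀ i, i + 1 < n → δ (i + 1) = D i + C (A (n - 2 - i)) * D (n - 1) := fun i hi => by
    simp only [δ, if_neg hi.ne, Nat.succ_ne_zero, if_false, Nat.add_sub_cancel]
    rw [show n - 1 - (i + 1) = n - 2 - i by omega]
  have hδn : δ n = D (n - 1) := by simp [δ]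
  have hl : ∀ e : Fin 2, ∀ i ≤ n, tilCoord n a i (AdjoinRoot.mk (qPoly (F2 z) n a)
      (solPoly n a fun j => embP z e (D j))) = embP z e (D i) := fun e i hi =>
    tilCoord_expansion n a (fun j => embP z e (D j)) i hi
  have hlu : ∀ e : Fin 2, ∀ i ≤ n, tilCoord n a i (u * AdjoinRoot.mk (qPoly (F2 z) n a)
      (solPoly n a fun j => embP z e (D j))) = embP z e (δ i) := fun e i hi => by
    obtain ⟨h1, h2, h3⟩ := tilCoord_root_mul n a hn0 (AdjoinRoot.mk (qPoly (F2 z) n a)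
      (solPoly n a fun j => embP z e (D j)))
    obtain rfl | hin := eq_or_ne i n
    · rw [h1, hδn, hl e _ (Nat.sub_le _ _)]
    obtain rfl | ⟨j, rfl⟩ : i = 0 ∨ ∃ j, i = j + 1 := by
      cases i
      exacts [Or.inl rfl, Or.inr ⟨_, rfl⟩]
    · rw [h2, hδ0, hl e _ le_rfl, hl e _ (Nat.sub_le _ _)]
      simp only [map_add, map_mul, hC, ha]
    · rw [h3 j (by omega), hδ j (by omega), hl e _ (by omega), hl e _ (Nat.sub_le _ _)]
      simp only [map_add, map_mul, hC, ha]
  have hone : ∀ i, tilCoord n a i 1 = if i = 0 then 1 else 0 := fun i => by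
    rw [← tilCoord_root_pow n a i 0 (by omega), pow_zero]
  have hroot : ∀ i, tilCoord n a i u = if i = 1 then 1 else 0 := fun i => by
    rw [← tilCoord_root_pow n a i 1 (by omega), pow_one]
  obtain ⟨h1, h2, -⟩ := tilCoord_root_mul n a hn0 (f * g)
  refine coordinates_of_symmetric_equation n hn A hA (embP z 0).toRingHom (embP z 1).toRingHom
    (fun c => ?_) (embP_injective z 0) (embP_injective z 1) ?_ ?_ eq_C_mul_of_embP_mul_eq
    D δ (fun i => tilCoord n a i (f * g)) (fun i => tilCoord n a i (u * (f * g)))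
    hD hδn hδ0 hδ h1 ?_ fun i hi j hj => ?_
  · exact (hC 1 c).trans (hC 0 c).symm
  · change embP z 0 X - embP z 1 X ≠ 0
    rw [embP_X_zero, embP_X_one]
    exact xvar_sub_yvar_ne_zero
  · change embP z 0 X * embP z 1 X - 1 ≠ 0
    rw [embP_X_zero, embP_X_one]
    exact xvar_mul_yvar_sub_one_ne_zero
  · refine h2.trans ?_
    change _ = embP z 0 _ * _ + embP z 0 _ * _
    rw [hC, hC]
  · have := hco i j
    dsimp only at this
    rw [hf, hg, hl 0 i hi, hl 0 j hj, hl 1 i hi, hl 1 j hj, hlu 0 i hi, hlu 0 j hj,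
      hlu 1 i hi, hlu 1 j hj, ← hf, ← hg, hone, hone, hroot, hroot] at this
    exact this

end Parameter

/-- uniqueness of principal solutions. Fix n ≥ 2, 𝔷 a field and
p(0) = Aₙ ≠ 0. Every principal solution of the reflection equation with spectral parameter
equals f(x)·K_p(ξ, p(0)/ξ, x) for some f ∈ 𝔷(x) and some non-zero ξ ∈ 𝔷. -/
theorem principal_solution_unique [CharZero k] {zf : Type} [Field zf] [Algebra k zf]
    (q : k) (hq0 : q ≠ 0) (hq1 : q ≠ 1) (hq1' : q ≠ -1)
    (ωf : zf) (hω : ωf = algebraMap k zf (q - q⁻¹))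
    (n : ℕ) (hn : 2 ≤ n) (A : ℕ → zf) (hA : A n ≠ 0) :
    ∀ c ∈ KpX k zf ωf n A,
      IsSol k (q - q⁻¹) (Rp zf ωf n A) c →
      IsPrincipal k zf ωf n A c →
      ∃ f : RatFunc k ⊗[k] Hp zf ωf n A, IsScalarElt k zf f ∧
        ∃ xi : zf, xi ≠ 0 ∧ c = f * KxMain k zf ωf n A xi (A n / xi) := by
  intro c _ hsol hprin
  have : CharZero zf := charZero_of_injective_algebraMap (algebraMap k zf).injective
  have hωf : ωf ≠ 0 := by
    rw [hω, map_ne_zero_iff _ (algebraMap k zf).injective, sub_ne_zero]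
    intro h
    have h2 : q * q = 1 := by
      nth_rw 2 [h]
      exact mul_inv_cancel₀ hq0
    rcases mul_self_eq_one_iff.1 h2 with h | h
    exacts [hq1 h, hq1' h]
  obtain ⟨g, r, D, hg, hr, hDn, hrg, hD⟩ := hprin.exists_coordinates ωf n hn A c
  obtain ⟨ξ, hξ, h1, h0⟩ := exists_parameter n hn A hA ωf hωf D hDn
    fun Q _ _ K Y => reflection_of_isSol (q - q⁻¹) ωf hω n A c hsol r D hD
      (baseChange k zf) (algebraMap zf (F2 zf)) baseChange_const
      (fun i => (embP zf i).toRingHom) (fun i a => (embP zf i).commutes a)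
      (fun i => (baseChange_embP_X i).symm) Q K Y
  exact ⟨g, hg, ξ, hξ, eq_mul_KxMain ωf n (by omega) A ξ (A n / ξ) c g r hr D hD hrg h1 h0⟩

end Baxterization
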